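/- arXiv:1402.4615 — 6 statements merged into one kernel-verified Lean document; each statement's English description precedes it below -/
import Mathlib

section
/- Fix multisets μ, ν, π of natural numbers all of whose elements are at least 2 (encoding partitions with no part equal to 1), and assume π.sum − π.card ≤ (μ.sum − μ.card) + (ν.sum − ν.card); set d = (μ.sum − μ.card) + (ν.sum − ν.card) − (π.sum − π.card). Then there exists a polynomial P with rational coefficients of degree at most d such that for every natural number n and every permutation σ of Fin n with Equiv.Perm.cycleType σ = π, the number of pairs (σ₁, σ₂) of permutations of Fin n with cycleType σ₁ = μ, cycleType σ₂ = ν and σ₁ * σ₂ = σ equals P evaluated at n. (Farahat–Higman polynomiality of the structure constants of the center of the symmetric group algebra, with the degree bound coming from the α = 1 specialization of the paper's main structure-constant theorem.) -/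
section FH
open Equiv Equiv.Perm Finset

lemma fh_filter_eq {α : Type*} [Fintype α] [DecidableEq α] (h : Perm α) (a b : α) :
    (h.cycleFactorsFinset.filter (fun c => c a = a ∧ c b = b))
      ⊆ ((swap a b * h).cycleFactorsFinset.filter (fun c => c a = a ∧ c b = b)) := by
  intro c hc
  rw [mem_filter, mem_cycleFactorsFinset_iff] at hc ⊢
  obtain ⟨⟨h1, h2⟩, h3, h4⟩ := hc
  refine ⟨⟨h1, fun x hx => ?_⟩, h3, h4⟩
  have hx' : c x ∈ c.support := apply_mem_support.2 hx
  rw [Perm.mul_apply, ← h2 x hx, swap_apply_of_ne_of_ne]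
  · intro e; rw [e] at hx'; exact (mem_support.1 hx') h3
  · intro e; rw [e] at hx'; exact (mem_support.1 hx') h4

lemma fh_touch {α : Type*} [Fintype α] [DecidableEq α] (h : Perm α) (a b : α) :
    (h.cycleFactorsFinset.filter (fun c => ¬ (c a = a ∧ c b = b)))
      = (({a, b} : Finset α).filter (fun x => h x ≠ x)).image (fun x => h.cycleOf x) := by
  ext c
  simp only [mem_filter, mem_image, mem_insert, mem_singleton]
  constructor
  · rintro ⟨hc, hn⟩
    by_cases ha : c a = a
    · have hb : c b ≠ b := fun e => hn ⟨ha, e⟩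
      have := cycle_is_cycleOf (mem_support.2 hb) hc
      refine ⟨b, ⟨Or.inr rfl, ?_⟩, this.symm⟩
      rwa [this, cycleOf_apply_self] at hb
    · have := cycle_is_cycleOf (mem_support.2 ha) hc
      refine ⟨a, ⟨Or.inl rfl, ?_⟩, this.symm⟩
      rwa [this, cycleOf_apply_self] at ha
  · rintro ⟨x, ⟨hx, hxx⟩, rfl⟩
    refine ⟨cycleOf_mem_cycleFactorsFinset_iff.2 (mem_support.2 hxx), ?_⟩
    rintro ⟨h1, h2⟩
    rcases hx with rfl | rfl
    · rw [cycleOf_apply_self] at h1; exact hxx h1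
    · rw [cycleOf_apply_self] at h2; exact hxx h2

lemma fh_count {α : Type*} [Fintype α] [DecidableEq α] (h : Perm α) (a b : α) :
    ∃ N : ℕ, ∀ k : Perm α, (k = h ∨ k = swap a b * h) → k.cycleType.card =
      N + ((({a, b} : Finset α).filter (fun x => k x ≠ x)).image (fun x => k.cycleOf x)).card := by
  have key : ∀ k : Perm α, k.cycleType.card =
      (k.cycleFactorsFinset.filter (fun c => c a = a ∧ c b = b)).card +
      ((({a, b} : Finset α).filter (fun x => k x ≠ x)).image (fun x => k.cycleOf x)).card := by
    intro k
    rw [← fh_touch, card_filter_add_card_filter_not, cycleType_def, Multiset.card_map]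
    rfl
  refine ⟨(h.cycleFactorsFinset.filter (fun c => c a = a ∧ c b = b)).card, fun k hk => ?_⟩
  · rw [key k]
    congr 1
    rcases hk with rfl | rfl
    · rfl
    · have h1 := fh_filter_eq h a b
      have h2 := fh_filter_eq (swap a b * h) a b
      rw [swap_mul_self_mul] at h2
      exact congrArg _ (h2.antisymm h1)

/-- general bound -/
lemma fh_one {α : Type*} [Fintype α] [DecidableEq α] (h : Perm α) (a b : α) :
    h.cycleType.card ≤ (swap a b * h).cycleType.card + 1 := by
  obtain ⟨N, hN⟩ := fh_count h a b
  rw [hN _ (Or.inl rfl), hN _ (Or.inr rfl)]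
  by_contra hcon
  push Not at hcon
  set I := ((({a, b} : Finset α).filter (fun x => h x ≠ x)).image (fun x => h.cycleOf x))
  set J := ((({a, b} : Finset α).filter (fun x => (swap a b * h) x ≠ x)).image
    (fun x => (swap a b * h).cycleOf x))
  have hI : 2 ≤ I.card := by omega
  have hJ : J = ∅ ∨ J.Nonempty := J.eq_empty_or_nonempty
  have hI2 : I.card ≤ 2 := (card_image_le.trans (card_filter_le _ _)).trans card_le_two
  rcases hJ with hJ | hJ
  · simp only [J, image_eq_empty, filter_eq_empty_iff, mem_insert, mem_singleton] at hJ
    have hb := hJ (x := b) (Or.inr rfl)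
    simp only [Perm.mul_apply, ne_eq, not_not] at hb
    have hba : h b = a := by
      have := congrArg (swap a b) hb
      simpa using this
    have : h.cycleOf a = h.cycleOf b := by
      rw [← hba]; exact (cycleOf_self_apply h b)
    have hs : I ⊆ {h.cycleOf b} := by
      intro c hc
      simp only [I, mem_image, mem_filter, mem_insert, mem_singleton] at hc ⊢
      obtain ⟨x, ⟨rfl | rfl, -⟩, rfl⟩ := hc
      · exact this
      · rfl
    have := card_le_card hs
    rw [card_singleton] at this
    omega
  · have := hJ.card_pos
    omega

/-- attach the fixed point `a` to `b` -/
lemma fh_two {α : Type*} [Fintype α] [DecidableEq α] (h : Perm α) (a b : α) (hab : a ≠ b)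
    (ha : h a = a) :
    (swap a b * h).cycleType.card = h.cycleType.card + (if h b = b then 1 else 0) := by
  obtain ⟨N, hN⟩ := fh_count h a b
  rw [hN _ (Or.inl rfl), hN _ (Or.inr rfl), add_assoc]
  congr 1
  have e1 : ((({a, b} : Finset α).filter (fun x => (swap a b * h) x ≠ x)).image
    (fun x => (swap a b * h).cycleOf x)) = {(swap a b * h).cycleOf a} := by
    have hga : (swap a b * h) a = b := by simp [ha]
    have hgb : (swap a b * h) b ≠ b := by
      intro e
      have := hga.trans e.symm
      exact hab ((swap a b * h).injective this)
    have : (({a, b} : Finset α).filter (fun x => (swap a b * h) x ≠ x)) = {a, b} := by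
      rw [filter_eq_self]
      intro x hx
      simp only [mem_insert, mem_singleton] at hx
      rcases hx with rfl | rfl
      · rw [hga]; exact hab.symm
      · exact hgb
    rw [this, image_insert, image_singleton]
    have : (swap a b * h).cycleOf b = (swap a b * h).cycleOf a := by
      have := cycleOf_self_apply (swap a b * h) a
      rwa [hga] at this
    rw [this]; simp
  rw [e1, card_singleton]
  split_ifs with hb
  · simp [ filter_insert, filter_singleton, ha, hb]
  · simp [ filter_insert, filter_singleton, ha, hb]

lemma fh_rank {α : Type*} [Fintype α] [DecidableEq α] (m : ℕ) : ∀ (f g : Perm α),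
    f.support.card ≤ m →
    (f.support ∪ g.support).card + f.cycleType.card + g.cycleType.card
      ≤ f.support.card + g.support.card + (f * g).cycleType.card := by
  induction m with
  | zero =>
    intro f g hf
    have : f = 1 := by simpa using hf
    subst this
    simp
  | succ m ih =>
    intro f g hf
    by_cases hf1 : f = 1
    · subst hf1; simp
    obtain ⟨a, ha⟩ : ∃ a, f a ≠ a := by
      by_contra hcon; push Not at hcon; exact hf1 (Equiv.ext hcon)
    obtain ⟨b, hb⟩ : ∃ b, b = f a := ⟨_, rfl⟩
    have hab : a ≠ b := by rw [hb]; exact ha.symm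
    obtain ⟨h, hh⟩ : ∃ h, h = swap a b * f := ⟨_, rfl⟩
    have hf' : f = swap a b * h := by rw [hh, swap_mul_self_mul]
    have hha : h a = a := by rw [hh, Perm.mul_apply, ← hb, swap_apply_right]
    have hsupp : f.support = h.support ∪ {a, b} := by
      ext x
      simp only [mem_support, mem_union, mem_insert, mem_singleton]
      by_cases hxa : x = a
      · subst hxa; simp [ha]
      by_cases hxb : x = b
      · subst hxb
        simp only [or_true, iff_true]
        intro e; exact hab (f.injective (hb.symm.trans e.symm))
      simp only [hxa, hxb, or_false]
      rw [hf', Perm.mul_apply]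
      by_cases hhb : h x = b
      · rw [hhb]; simp; constructor
        · intro _ e; exact hxb e.symm
        · intro _ e; exact hxa e.symm
      · rw [swap_apply_of_ne_of_ne _ hhb]
        intro e; exact hxa (h.injective (e.trans hha.symm))
    have haS : a ∉ h.support := by simp [hha]
    have hins : f.support = insert a (insert b h.support) := by
      rw [hsupp]; ext x; simp
    have hL := fh_two h a b hab hha
    rw [← hf'] at hL
    have hcardf : f.support.card = h.support.card + (if h b = b then 2 else 1) := by
      rw [hins, card_insert_of_notMem (by simp [hab, hha])]
      split_ifs with hbb
      · rw [card_insert_of_notMem (by simp [hbb])]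
      · rw [insert_eq_of_mem (by simp [hbb])]
    have IH := ih h g (by split_ifs at hcardf <;> omega)
    have hfg : f * g = swap a b * (h * g) := by rw [hf', mul_assoc]
    have hU : f.support ∪ g.support = insert a (insert b (h.support ∪ g.support)) := by
      rw [hins]; ext x; simp
    have h1 := fh_one (h * g) a b
    rw [← hfg] at h1
    have main : (f.support ∪ g.support).card + (h * g).cycleType.card
        ≤ (h.support ∪ g.support).card + 1 + (f * g).cycleType.card := by
      have fixmul : ∀ x, x ∉ h.support ∪ g.support → (h * g) x = x := by
        intro x hx
        simp only [mem_union, mem_support, not_or, not_not] at hx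
        rw [Perm.mul_apply, hx.2, hx.1]
      rw [hU]
      by_cases hA : a ∈ h.support ∪ g.support <;> by_cases hB : b ∈ h.support ∪ g.support
      · rw [insert_eq_of_mem hB, insert_eq_of_mem hA]; omega
      · have := fh_two (h * g) b a hab.symm (fixmul b hB)
        rw [swap_comm, ← hfg] at this
        rw [insert_eq_of_mem (mem_insert_of_mem hA), card_insert_of_notMem hB]
        omega
      · have := fh_two (h * g) a b hab (fixmul a hA)
        rw [← hfg] at this
        rw [insert_eq_of_mem hB, card_insert_of_notMem hA]
        omega
      · have := fh_two (h * g) a b hab (fixmul a hA)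
        rw [← hfg, if_pos (fixmul b hB)] at this
        rw [card_insert_of_notMem (by simp only [mem_insert, not_or]; exact ⟨hab, hA⟩),
          card_insert_of_notMem hB]
        omega
    split_ifs at hL hcardf <;> omega

lemma fh_restrict {α β : Type*} [Fintype β] [DecidableEq β]
    (S : Finset β) (e : α ≃ {x // x ∈ S}) (f : Perm β) (hf : f.support ⊆ S) :
    ∃ f' : Perm α, f'.extendDomain e = f := by
  have h : ∀ x, f x ∈ S ↔ x ∈ S := by
    intro x
    by_cases hx : f x = x
    · rw [hx]
    · exact iff_of_true (hf (apply_mem_support.2 (mem_support.2 hx))) (hf (mem_support.2 hx))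
  refine ⟨e.symm.permCongr (f.subtypePerm h), ?_⟩
  ext x
  by_cases hx : x ∈ S
  · rw [extendDomain_apply_subtype _ _ hx]
    simp
  · rw [extendDomain_apply_not_subtype _ _ hx]
    by_contra hcon
    exact hx (hf (mem_support.2 (fun h => hcon h.symm)))

/-- pairs with prescribed cycle types, product and union of supports -/
def fhPairs {α : Type*} [Fintype α] [DecidableEq α] (μ ν : Multiset ℕ) (σ : Perm α)
    (S : Finset α) : Finset (Perm α × Perm α) :=
  univ.filter (fun p => (p.1.cycleType = μ ∧ p.2.cycleType = ν ∧ p.1 * p.2 = σ) ∧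
    p.1.support ∪ p.2.support = S)

lemma fh_transfer {α β : Type*} [Fintype α] [DecidableEq α] [Fintype β] [DecidableEq β]
    (μ ν : Multiset ℕ) (S : Finset β) (e : α ≃ {x // x ∈ S}) (τ : Perm α) :
    (fhPairs μ ν τ univ).card = (fhPairs μ ν (τ.extendDomain e) S).card := by
  have inj : ∀ f g : Perm α, f.extendDomain e = g.extendDomain e → f = g := fun f g h =>
    extendDomainHom_injective e h
  have hS : (univ : Finset α).map e.asEmbedding = S := by
    ext x
    simp only [mem_map, mem_univ, true_and, asEmbedding_apply]
    constructor
    · rintro ⟨a, rfl⟩; exact (e a).2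
    · intro hx; exact ⟨e.symm ⟨x, hx⟩, by simp⟩
  refine card_bij (fun p _ => (p.1.extendDomain e, p.2.extendDomain e)) ?_ ?_ ?_
  · rintro ⟨f, g⟩ h
    simp only [fhPairs, mem_filter, mem_univ, true_and] at h ⊢
    obtain ⟨⟨h1, h2, h3⟩, h4⟩ := h
    refine ⟨⟨?_, ?_, ?_⟩, ?_⟩
    · rw [cycleType_extendDomain, h1]
    · rw [cycleType_extendDomain, h2]
    · rw [extendDomain_mul, h3]
    · rw [support_extend_domain, support_extend_domain, ← map_union, h4, hS]
  · rintro ⟨f, g⟩ - ⟨f', g'⟩ - h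
    simp only [Prod.mk.injEq] at h
    rw [inj _ _ h.1, inj _ _ h.2]
  · rintro ⟨f, g⟩ h
    simp only [fhPairs, mem_filter, mem_univ, true_and] at h
    obtain ⟨⟨h1, h2, h3⟩, h4⟩ := h
    obtain ⟨f', rfl⟩ := fh_restrict S e f (h4 ▸ subset_union_left)
    obtain ⟨g', rfl⟩ := fh_restrict S e g (h4 ▸ subset_union_right)
    refine ⟨(f', g'), ?_, rfl⟩
    simp only [fhPairs, mem_filter, mem_univ, true_and]
    rw [cycleType_extendDomain] at h1 h2
    rw [extendDomain_mul] at h3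
    refine ⟨⟨h1, h2, inj _ _ h3⟩, ?_⟩
    rw [support_extend_domain, support_extend_domain, ← map_union] at h4
    exact map_injective _ (h4.trans hS.symm)

lemma fh_canon {α β : Type*} [Fintype α] [DecidableEq α] [Fintype β] [DecidableEq β]
    (μ ν : Multiset ℕ) (S : Finset β) (hc : Fintype.card α = S.card) (σ₀ : Perm α) (σ : Perm β)
    (hS : σ.support ⊆ S) (hσ : σ₀.cycleType = σ.cycleType) :
    (fhPairs μ ν σ S).card = (fhPairs μ ν σ₀ univ).card := by
  have e₀ : α ≃ {x // x ∈ S} := Fintype.equivOfCardEq (by simpa using hc)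
  obtain ⟨τ, hτ⟩ := fh_restrict S e₀ σ hS
  have hconj : IsConj σ₀ τ := by
    rw [isConj_iff_cycleType_eq, hσ, ← hτ, cycleType_extendDomain]
  obtain ⟨c, hc⟩ := isConj_iff.1 hconj
  have : σ₀.extendDomain (Equiv.trans c e₀) = σ := by
    rw [← hτ, ← hc]
    ext x
    by_cases hx : x ∈ S
    · rw [extendDomain_apply_subtype _ _ hx, extendDomain_apply_subtype _ _ hx]
      simp
      try rfl
    · rw [extendDomain_apply_not_subtype _ _ hx, extendDomain_apply_not_subtype _ _ hx]
  rw [fh_transfer μ ν S (Equiv.trans c e₀) σ₀, this]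

lemma fh_total {β : Type*} [Fintype β] [DecidableEq β] (μ ν : Multiset ℕ) (σ : Perm β)
    (A : ℕ → ℕ) (hA : ∀ S : Finset β, σ.support ⊆ S →
      (fhPairs μ ν σ S).card = A (S.card - σ.support.card)) :
    Nat.card {p : Perm β × Perm β //
            p.1.cycleType = μ ∧ p.2.cycleType = ν ∧ p.1 * p.2 = σ}
      = ∑ j ∈ range ((Fintype.card β - σ.support.card) + 1),
        (Fintype.card β - σ.support.card).choose j * A j := by
  rw [Nat.card_eq_fintype_card, Fintype.card_subtype]
  have hmap : ∀ p ∈ (univ.filter (fun p : Perm β × Perm β =>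
      p.1.cycleType = μ ∧ p.2.cycleType = ν ∧ p.1 * p.2 = σ)),
      (p.1.support ∪ p.2.support) \ σ.support ∈ (σ.supportᶜ).powerset := by
    intro p _
    rw [mem_powerset]
    intro x hx
    rw [mem_compl]
    exact (mem_sdiff.1 hx).2
  rw [card_eq_sum_card_fiberwise hmap, ← card_compl]
  have := sum_powerset_apply_card A (x := σ.supportᶜ)
  simp only [smul_eq_mul] at this
  rw [← this]
  refine sum_congr rfl fun T hT => ?_
  have hdis : _root_.Disjoint T σ.support := by
    rw [mem_powerset] at hT
    exact disjoint_left.2 fun x hx => mem_compl.1 (hT hx)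
  have h1 := hA (T ∪ σ.support) subset_union_right
  rw [card_union_of_disjoint hdis, Nat.add_sub_cancel] at h1
  rw [← h1, fhPairs, filter_filter]
  congr 1
  refine filter_congr fun p _ => ?_
  refine and_congr_right fun hp => ?_
  have hsub : σ.support ⊆ p.1.support ∪ p.2.support := by
    rw [← hp.2.2]; exact support_mul_le _ _
  constructor
  · rintro rfl; rw [sdiff_union_of_subset hsub]
  · intro h; rw [h, union_sdiff_cancel_right hdis]

end FH

/-- Farahat–Higman polynomiality of the structure constants of the center of the
symmetric group algebra, with the degree bound from the α = 1 specialization of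
the paper's main structure-constant theorem. -/
theorem farahat_higman_polynomiality
    (μ ν π : Multiset ℕ)
    (hμ : ∀ x ∈ μ, 2 ≤ x) (hν : ∀ x ∈ ν, 2 ≤ x) (hπ : ∀ x ∈ π, 2 ≤ x)
    (hle : π.sum - π.card ≤ (μ.sum - μ.card) + (ν.sum - ν.card)) :
    ∃ P : Polynomial ℚ,
      P.natDegree ≤ (μ.sum - μ.card) + (ν.sum - ν.card) - (π.sum - π.card) ∧
      ∀ (n : ℕ) (σ : Equiv.Perm (Fin n)), σ.cycleType = π →
        (Nat.card {p : Equiv.Perm (Fin n) × Equiv.Perm (Fin n) //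
            p.1.cycleType = μ ∧ p.2.cycleType = ν ∧ p.1 * p.2 = σ} : ℚ)
          = P.eval (n : ℚ) := by
  have hex : ∀ j : ℕ, ∃ s : Equiv.Perm (Fin (π.sum + j)), s.cycleType = π := fun j =>
    (Equiv.Perm.exists_with_cycleType_iff _).2 ⟨by simp, hπ⟩
  choose s hs using hex
  obtain ⟨A, hAdef⟩ : ∃ A : ℕ → ℕ, ∀ j, A j = (fhPairs μ ν (s j) Finset.univ).card :=
    ⟨_, fun _ => rfl⟩
  obtain ⟨d, hd⟩ : ∃ d, d = (μ.sum - μ.card) + (ν.sum - ν.card) - (π.sum - π.card) := ⟨_, rfl⟩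
  have hcard : ∀ m : Multiset ℕ, (∀ x ∈ m, 2 ≤ x) → m.card ≤ m.sum := by
    intro m hm
    have := Multiset.card_nsmul_le_sum (s := m) (a := 1) (fun x hx => by have := hm x hx; omega)
    simpa using this
  have hA0 : ∀ j, d < j → A j = 0 := by
    intro j hj
    rw [hAdef, Finset.card_eq_zero, Finset.eq_empty_iff_forall_notMem]
    rintro ⟨f, g⟩ h
    simp only [fhPairs, Finset.mem_filter, Finset.mem_univ, true_and] at h
    obtain ⟨⟨h1, h2, h3⟩, h4⟩ := h
    have := fh_rank _ f g le_rfl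
    rw [h4, h3, ← Equiv.Perm.sum_cycleType, ← Equiv.Perm.sum_cycleType, h1, h2, hs,
      Finset.card_univ, Fintype.card_fin] at this
    have := hcard μ hμ
    have := hcard ν hν
    have := hcard π hπ
    omega
  rw [← hd]
  refine ⟨∑ j ∈ Finset.range (d + 1), Polynomial.C ((A j : ℚ) / (j.factorial : ℚ)) *
    (descPochhammer ℚ j).comp (Polynomial.X - Polynomial.C (π.sum : ℚ)), ?_, ?_⟩
  · refine Polynomial.natDegree_sum_le_of_forall_le _ _ fun j hj => ?_
    refine (Polynomial.natDegree_C_mul_le _ _).trans ?_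
    rw [Polynomial.natDegree_comp, descPochhammer_natDegree, Polynomial.natDegree_X_sub_C, mul_one]
    have := Finset.mem_range.1 hj
    omega
  · intro n σ hσ
    have hsup : σ.support.card = π.sum := by rw [← hσ, Equiv.Perm.sum_cycleType]
    have hn : π.sum ≤ n := by
      rw [← hsup]; simpa using Finset.card_le_univ σ.support
    rw [fh_total μ ν σ A, hsup, Fintype.card_fin]
    · rw [Polynomial.eval_finsetSum]
      have hterm : ∀ j, Polynomial.eval (n : ℚ) (Polynomial.C ((A j : ℚ) / (j.factorial : ℚ)) *
          (descPochhammer ℚ j).comp (Polynomial.X - Polynomial.C (π.sum : ℚ)))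
          = (((n - π.sum).choose j * A j : ℕ) : ℚ) := by
        intro j
        rw [Polynomial.eval_mul, Polynomial.eval_C, Polynomial.eval_comp, Polynomial.eval_sub,
          Polynomial.eval_X, Polynomial.eval_C, ← Nat.cast_sub hn, Nat.cast_mul,
          Nat.cast_choose_eq_descPochhammer_div]
        ring
      rw [Finset.sum_congr rfl (fun j _ => hterm j), ← Nat.cast_sum]
      congr 1
      trans ∑ j ∈ Finset.range (max (n - π.sum) d + 1), (n - π.sum).choose j * A j
      · apply Finset.sum_subset
        · exact Finset.range_mono (by omega)
        · intro j _ hj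
          rw [Nat.choose_eq_zero_of_lt (by simpa using hj), zero_mul]
      · symm
        apply Finset.sum_subset
        · exact Finset.range_mono (by omega)
        · intro j _ hj
          rw [hA0 j (by simpa using hj), mul_zero]
    · intro S hS
      have hle' := Finset.card_le_card hS
      rw [hAdef]
      refine fh_canon μ ν S ?_ _ σ hS ((hs _).trans hσ.symm)
      rw [Fintype.card_fin]
      omega
end

section
/- Fix multisets μ, ν, π of natural numbers all of whose elements are at least 2, and assume π.sum − π.card ≤ (μ.sum − μ.card) + (ν.sum − ν.card); set d = (μ.sum − μ.card) + (ν.sum − ν.card) − (π.sum − π.card). Then there exist a polynomial P with real coefficients and a polynomial Q with rational coefficients, both of degree at most d, whose coefficients of X^d agree (casting Q's coefficient into ℝ), such that: (i) for every n and every permutation σ of Fin n with cycleType σ = π, the number of pairs (σ₁, σ₂) of permutations of Fin n with cycleType σ₁ = μ, cycleType σ₂ = ν and σ₁ * σ₂ = σ equals Q evaluated at n; and (ii) for every n and all fixed-point-free involutions F₁, F₂ of Fin (2n) with cycleType (F₁ * F₂) = π + π, the number of fixed-point-free involutions F₃ of Fin (2n) with cycleType (F₁ * F₃) = μ + μ and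 cycleType (F₂ * F₃) = ν + ν equals (√2)^d times P evaluated at n. (This is the paper's analogue of Farahat–Higman's theorem for the Hecke algebra of the pair (S_{2n}, H_n), expressed via perfect matchings.) -/
/-- A fixed-point-free involution, encoding a perfect matching. -/
def IsPerfectMatching {α : Type*} (F : Equiv.Perm α) : Prop :=
  F * F = 1 ∧ ∀ x, F x ≠ x

namespace HFH
set_option linter.unusedSectionVars false
open Equiv Equiv.Perm

lemma PM_app {V : Type*} {F : Perm V} (h : IsPerfectMatching F) (x : V) : F (F x) = x := by
  have := congrArg (fun f : Perm V => f x) h.1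
  simpa using this

lemma PM_inv {V : Type*} {F : Perm V} (h : IsPerfectMatching F) : F⁻¹ = F :=
  inv_eq_of_mul_eq_one_left h.1

section
variable {V W : Type*} [Fintype V] [DecidableEq V] [Fintype W] [DecidableEq W]

lemma ct_permCongr (e : V ≃ W) (g : Perm V) : (e.permCongr g).cycleType = g.cycleType := by
  have := cycleType_extendDomain (p := fun _ : W => True)
    (e.trans (Equiv.subtypeUnivEquiv (fun _ => trivial)).symm) (g := g)
  rw [← this]
  congr 1

lemma ct_sumCongr (a : Perm V) (b : Perm W) :
    (Perm.sumCongr a b).cycleType = a.cycleType + b.cycleType := by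
  have h : (Perm.sumCongr a b) =
      Perm.sumCongr a (1 : Perm W) * Perm.sumCongr (1 : Perm V) b := by
    rw [Perm.sumCongr_mul]; simp
  rw [h, Disjoint.cycleType_mul]
  · congr 1
    · rw [← cycleType_extendDomain (p := fun x : V ⊕ W => x.isLeft = true)
        (f := (⟨fun v => ⟨Sum.inl v, rfl⟩, fun x => x.1.getLeft x.2, fun v => rfl,
          fun x => by rcases x with ⟨x | x, h⟩ <;> simp at h ⊢⟩)) (g := a)]
      congr 1
      ext x : 1
      rcases x with x | x
      · rw [extendDomain_apply_subtype _ _ (by simp)]; rfl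
      · rw [extendDomain_apply_not_subtype _ _ (by simp)]; simp
    · rw [← cycleType_extendDomain (p := fun x : V ⊕ W => x.isRight = true)
        (f := (⟨fun v => ⟨Sum.inr v, rfl⟩, fun x => x.1.getRight x.2, fun v => rfl,
          fun x => by rcases x with ⟨x | x, h⟩ <;> simp at h ⊢⟩)) (g := b)]
      congr 1
      ext x : 1
      rcases x with x | x
      · rw [extendDomain_apply_not_subtype _ _ (by simp)]; simp
      · rw [extendDomain_apply_subtype _ _ (by simp)]; rfl
  · intro x
    rcases x with x | x <;> simp

lemma card_sameCycle (σ : Perm V) :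
    Nat.card (Quotient (SameCycle.setoid σ)) + σ.cycleType.sum
      = Fintype.card V + σ.cycleType.card := by
  classical
  let Φ : V → Perm V ⊕ V := fun x => if σ x = x then Sum.inr x else Sum.inl (σ.cycleOf x)
  have hΦ : ∀ x y, Φ x = Φ y ↔ σ.SameCycle x y := by
    intro x y
    by_cases hx : σ x = x <;> by_cases hy : σ y = y
    · simp only [Φ, hx, hy, if_true, Sum.inr.injEq]
      constructor
      · rintro rfl; exact SameCycle.refl _ _
      · rintro h
        exact (h.eq_of_left hx)
    · simp only [Φ, hx, hy, if_true, if_false, reduceCtorEq, false_iff]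
      intro h; exact hy ((h.apply_eq_self_iff).1 hx)
    · simp only [Φ, hx, hy, if_true, if_false, reduceCtorEq, false_iff]
      intro h; exact hx ((h.apply_eq_self_iff).2 hy)
    · simp only [Φ, hx, hy, if_false, Sum.inl.injEq]
      constructor
      · intro h
        have : x ∈ (σ.cycleOf y).support := by
          rw [← h, mem_support, cycleOf_apply_self]; exact hx
        exact ((mem_support_cycleOf_iff.1 this).1).symm
      · intro h; exact h.cycleOf_eq
  have h1 : Nat.card (Quotient (SameCycle.setoid σ)) = Nat.card (Set.range Φ) := by
    have hs : SameCycle.setoid σ = Setoid.ker Φ := by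
      ext x y; exact (hΦ x y).symm
    rw [hs]
    exact Nat.card_congr (Setoid.quotientKerEquivRange Φ)
  have h2 : Set.range Φ =
      ((σ.cycleFactorsFinset.disjSum (Finset.univ.filter fun x => σ x = x) : Finset _) : Set _) := by
    ext y
    rcases y with y | y
    · simp only [Set.mem_range, Finset.mem_coe, Finset.inl_mem_disjSum, Φ]
      constructor
      · rintro ⟨x, hx⟩
        split_ifs at hx with h
        rw [Sum.inl.injEq] at hx
        rw [← hx, cycleOf_mem_cycleFactorsFinset_iff, mem_support]; exact h
      · intro hy
        obtain ⟨x, hx⟩ := (mem_cycleFactorsFinset_iff.1 hy).1.nonempty_support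
        have hxs : x ∈ σ.support := mem_cycleFactorsFinset_support_le hy hx
        refine ⟨x, ?_⟩
        rw [mem_support] at hxs
        rw [if_neg hxs, ← cycle_is_cycleOf hx hy]
    · simp only [Set.mem_range, Finset.mem_coe, Finset.inr_mem_disjSum, Φ]
      constructor
      · rintro ⟨x, hx⟩
        split_ifs at hx with h
        rw [Sum.inr.injEq] at hx
        subst hx; simpa using h
      · intro hy
        refine ⟨y, ?_⟩
        rw [if_pos (by simpa using hy)]
  have h4 : Nat.card (Set.range Φ)
      = σ.cycleFactorsFinset.card + (Finset.univ.filter fun x => σ x = x).card := by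
    rw [h2, Nat.card_coe_set_eq, Set.ncard_coe_finset, Finset.card_disjSum]
  rw [h1, h4]
  have h3 : σ.cycleType.card = σ.cycleFactorsFinset.card := by
    rw [cycleType_def]; simp
  rw [h3, sum_cycleType]
  have h5 : (Finset.univ.filter fun x => σ x = x).card + σ.support.card = Fintype.card V := by
    have := Finset.card_filter_add_card_filter_not (s := (Finset.univ : Finset V)) (fun x => σ x = x)
    rw [Finset.card_univ] at this
    rw [← this]; congr 1
  omega

lemma exists_col {F1 F2 : Perm V} (h1 : IsPerfectMatching F1) (h2 : IsPerfectMatching F2) :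
    ∃ c : V → Bool, (∀ x, c (F1 x) = !c x) ∧ (∀ x, c (F2 x) = !c x) := by
  classical
  set σ := F1 * F2 with hσ
  have i1 : F1⁻¹ = F1 := PM_inv h1
  have i2 : F2⁻¹ = F2 := PM_inv h2
  have hc : F1 * σ * F1⁻¹ = σ⁻¹ := by
    rw [hσ, mul_inv_rev, i1, i2, ← mul_assoc, h1.1, one_mul]
  have hz : ∀ (k : ℤ) x, F1 ((σ ^ k) x) = (σ ^ (-k)) (F1 x) := by
    intro k x
    have : F1 * σ ^ k * F1⁻¹ = σ ^ (-k) := by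
      rw [← conj_zpow, hc, inv_zpow, zpow_neg]
    rw [← this]; simp
  have hF2 : ∀ x, F2 x = F1 (σ x) := by
    intro x; simp [hσ, PM_app h1]
  have key : ∀ x, ¬ σ.SameCycle x (F1 x) := by
    rintro x ⟨k, hk⟩
    rcases Int.even_or_odd' k with ⟨j, rfl | rfl⟩
    · apply h1.2 ((σ ^ j) x)
      rw [hz, ← hk, ← mul_apply, ← zpow_add]
      congr 2; ring
    · apply h2.2 ((σ ^ j) x)
      rw [hF2]
      have : σ ((σ ^ j) x) = (σ ^ (j+1)) x := by
        rw [add_comm, zpow_add, zpow_one]; rfl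
      rw [this, hz, ← hk, ← mul_apply, ← zpow_add]
      congr 2; ring
  have s1 : ∀ x, σ.SameCycle (F2 x) (F1 x) := by
    intro x
    rw [hF2]
    have := hz 1 x
    rw [zpow_one] at this
    rw [this]
    refine ⟨1, ?_⟩
    rw [← mul_apply, ← zpow_add]; simp
  have s2 : ∀ x, σ.SameCycle (F1 (F2 x)) x := by
    intro x
    exact SameCycle.symm ⟨1, by simp [hσ]⟩
  obtain ⟨ι, hι⟩ : ∃ ι : Quotient (SameCycle.setoid σ) → ℕ, Function.Injective ι := by
    obtain ⟨n, ⟨e⟩⟩ := Finite.exists_equiv_fin (Quotient (SameCycle.setoid σ))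
    exact ⟨fun q => e q, fun a b h => e.injective (Fin.ext h)⟩
  let q : V → ℕ := fun x => ι (Quotient.mk (SameCycle.setoid σ) x)
  have hq : ∀ x y, q x = q y ↔ σ.SameCycle x y := by
    intro x y
    constructor
    · intro h; exact Quotient.exact (s := SameCycle.setoid σ) (hι h)
    · intro h; exact congrArg ι (Quotient.sound (s := SameCycle.setoid σ) h)
  refine ⟨fun x => decide (q x < q (F1 x)), ?_, ?_⟩
  · intro x
    have : q x ≠ q (F1 x) := fun h => key x ((hq _ _).1 h)
    simp only [PM_app h1]
    by_cases hh : q x < q (F1 x)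
    · simp [hh, hh.le]
    · have : q (F1 x) < q x := by omega
      simp [this, this.le]
  · intro x
    have : q x ≠ q (F1 x) := fun h => key x ((hq _ _).1 h)
    simp only [(hq _ _).2 (s1 x), (hq _ _).2 (s2 x)]
    by_cases hh : q x < q (F1 x)
    · simp [hh, hh.le]
    · have : q (F1 x) < q x := by omega
      simp [this, this.le]

end
end HFH

namespace HFH
set_option linter.unusedSectionVars false
open Equiv Equiv.Perm

section
variable {A V : Type*}

/-- the model matching on `A ⊕ A` attached to a permutation -/
def Js (σ : Perm A) : Perm (A ⊕ A) where
  toFun := Sum.elim (fun a => Sum.inr (σ a)) (fun a => Sum.inl (σ.symm a))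
  invFun := Sum.elim (fun a => Sum.inr (σ a)) (fun a => Sum.inl (σ.symm a))
  left_inv := by rintro (a | a) <;> simp
  right_inv := by rintro (a | a) <;> simp

lemma Js_inl (σ : Perm A) (a : A) : Js σ (Sum.inl a) = Sum.inr (σ a) := rfl
lemma Js_inr (σ : Perm A) (a : A) : Js σ (Sum.inr a) = Sum.inl (σ.symm a) := rfl

lemma Js_pm (σ : Perm A) : IsPerfectMatching (Js σ) := by
  constructor
  · ext x : 1
    rcases x with a | a <;> simp [Js_inl, Js_inr]
  · rintro (a | a) <;> simp [Js_inl, Js_inr]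

lemma Js_col (σ : Perm A) (x : A ⊕ A) : (Js σ x).isLeft = !x.isLeft := by
  rcases x with a | a <;> simp [Js_inl, Js_inr]

lemma ct_Js [Fintype A] [DecidableEq A] (σ τ : Perm A) :
    (Js σ * Js τ).cycleType = (σ⁻¹ * τ).cycleType + (σ⁻¹ * τ).cycleType := by
  have h : Js σ * Js τ = Perm.sumCongr (σ⁻¹ * τ) (σ * τ⁻¹) := by
    ext x : 1
    rcases x with a | a
    · simp [Js_inl, Js_inr]
    · simp [Js_inl, Js_inr]
  rw [h, ct_sumCongr]
  congr 1
  rw [← cycleType_inv (σ * τ⁻¹)]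
  rw [← cycleType_conj (σ := σ⁻¹ * τ) (τ := σ)]
  congr 1
  group

/-- orbits of two matchings -/
abbrev Q2 (F1 F2 : Perm V) := Quot (fun x y : V => y = F1 x ∨ y = F2 x)
/-- orbits of three matchings -/
abbrev Q3 (F1 F2 F3 : Perm V) := Quot (fun x y : V => y = F1 x ∨ y = F2 x ∨ y = F3 x)

/-- a colouring respected by a matching -/
def Resp (c : V → Bool) (F : Perm V) : Prop := ∀ x, c (F x) = !c x

/-- an isomorphism with the model -/
structure Mod (F1 F2 : Perm V) (c : V → Bool) (σ : Perm A) (e : V ≃ A ⊕ A) : Prop where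
  m1 : ∀ x, e (F1 x) = Js 1 (e x)
  m2 : ∀ x, e (F2 x) = Js σ (e x)
  mc : ∀ x, (e x).isLeft = c x

lemma model0 {F1 F2 : Perm V} {c : V → Bool} (h1 : IsPerfectMatching F1)
    (h2 : IsPerfectMatching F2) (c1 : Resp c F1) (c2 : Resp c F2) (σ : Perm A)
    (g : {x // c x = true} ≃ A)
    (hg : ∀ (x : V) (hx : c x = true) (hx' : c (F1 (F2 x)) = true),
      g ⟨F1 (F2 x), hx'⟩ = σ (g ⟨x, hx⟩)) :
    ∃ e : V ≃ A ⊕ A, Mod F1 F2 c σ e := by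
  have n1 : ∀ {x}, ¬ c x = true → c (F1 x) = true := by
    intro x hx; rw [c1]; simpa using hx
  have n1' : ∀ {x}, c x = true → ¬ c (F1 x) = true := by
    intro x hx; rw [c1]; simpa using hx
  have n2 : ∀ {x}, ¬ c x = true → c (F2 x) = true := by
    intro x hx; rw [c2]; simpa using hx
  have n2' : ∀ {x}, c x = true → ¬ c (F2 x) = true := by
    intro x hx; rw [c2]; simpa using hx
  refine ⟨⟨fun x => if h : c x = true then Sum.inl (g ⟨x, h⟩) else Sum.inr (g ⟨F1 x, n1 h⟩),
    Sum.elim (fun a => (g.symm a).1) (fun a => F1 (g.symm a).1), ?_, ?_⟩, ?_, ?_, ?_⟩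
  · intro x
    by_cases h : c x = true
    · simp [h]
    · simp [h, PM_app h1]
  · rintro (a | a)
    · simp [(g.symm a).2]
    · have := n1' (g.symm a).2
      simp [this, PM_app h1]
  · intro x
    by_cases h : c x = true
    · simp [h, n1' h, Js_inl, PM_app h1]
    · simp [h, n1 h, Js_inr]; rfl
  · intro x
    by_cases h : c x = true
    · have := hg x h (n1 (n2' h))
      simp [h, n2' h, Js_inl, this]
    · have := hg (F2 x) (n2 h) (by rw [PM_app h2]; exact n1 h)
      simp only [PM_app h2] at this
      simp [h, n2 h, Js_inr, this]
  · intro x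
    by_cases h : c x = true
    · simp [h]
    · simp [h]

end

section
variable {A V : Type*} [Fintype V] [DecidableEq V] [Fintype A] [DecidableEq A]

lemma Mod.permCongr_mul {F1 F2 : Perm V} {c : V → Bool} {σ : Perm A} {e : V ≃ A ⊕ A}
    (m : Mod F1 F2 c σ e) : e.permCongr (F1 * F2) = Js 1 * Js σ := by
  ext x : 1
  simp [Equiv.permCongr_apply, m.m1, m.m2]

lemma Mod.ct {F1 F2 : Perm V} {c : V → Bool} {σ : Perm A} {e : V ≃ A ⊕ A}
    (m : Mod F1 F2 c σ e) : (F1 * F2).cycleType = σ.cycleType + σ.cycleType := by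
  rw [← ct_permCongr e, m.permCongr_mul, ct_Js]; simp

lemma Mod.card {F1 F2 : Perm V} {c : V → Bool} {σ : Perm A} {e : V ≃ A ⊕ A}
    (_m : Mod F1 F2 c σ e) : Fintype.card V = 2 * Fintype.card A := by
  rw [Fintype.card_congr e, Fintype.card_sum]; ring

lemma add_self_inj {a b : Multiset ℕ} (h : a + a = b + b) : a = b := by
  ext x
  have := congrArg (Multiset.count x) h
  simp only [Multiset.count_add] at this
  omega

lemma model1 {F1 F2 : Perm V} {c : V → Bool} (h1 : IsPerfectMatching F1)
    (h2 : IsPerfectMatching F2) (c1 : Resp c F1) (c2 : Resp c F2) :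
    ∃ (τ : Perm {x // c x = true}) (e : V ≃ {x // c x = true} ⊕ {x // c x = true}),
      (∀ x, (τ x : V) = F1 (F2 x)) ∧ Mod F1 F2 c τ e := by
  have hp : ∀ x, c ((F1 * F2) x) = true ↔ c x = true := by
    intro x; simp [c1 (F2 x), c2 x]
  obtain ⟨e, he⟩ := model0 h1 h2 c1 c2 ((F1 * F2).subtypePerm hp) (Equiv.refl _)
    (by intro x hx hx'; rfl)
  exact ⟨_, e, fun x => rfl, he⟩

lemma model2 {F1 F2 : Perm V} {c : V → Bool} (h1 : IsPerfectMatching F1)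
    (h2 : IsPerfectMatching F2) (c1 : Resp c F1) (c2 : Resp c F2) (σ : Perm A)
    (hσ : (F1 * F2).cycleType = σ.cycleType + σ.cycleType)
    (hA : Fintype.card V = 2 * Fintype.card A) :
    ∃ e : V ≃ A ⊕ A, Mod F1 F2 c σ e := by
  obtain ⟨τ, e, hτ, m⟩ := model1 h1 h2 c1 c2
  have ht : τ.cycleType = σ.cycleType := add_self_inj (m.ct.symm.trans hσ)
  have hc : Fintype.card {x // c x = true} = Fintype.card A := by
    have := m.card; omega
  let g0 := Fintype.equivOfCardEq hc
  have h3 : (g0.permCongr τ).cycleType = σ.cycleType := by rw [ct_permCongr, ht]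
  obtain ⟨k, hk⟩ := isConj_iff.1 (isConj_of_cycleType_eq h3)
  refine model0 h1 h2 c1 c2 σ (g0.trans k) ?_
  intro x hx hx'
  rw [← hk]
  have : (⟨F1 (F2 x), hx'⟩ : {x // c x = true}) = τ ⟨x, hx⟩ := Subtype.ext (hτ ⟨x, hx⟩).symm
  rw [this]
  simp [Equiv.permCongr_apply]

lemma Mod.card_Q2 {F1 F2 : Perm V} {c : V → Bool} {σ : Perm A} {e : V ≃ A ⊕ A}
    (m : Mod F1 F2 c σ e) : Nat.card (Q2 F1 F2) = Nat.card (Quotient (SameCycle.setoid σ)) := by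
  let s := SameCycle.setoid σ
  have key : ∀ y : A ⊕ A, (Sum.elim (Quotient.mk s) (Quotient.mk s) (Js σ y)) =
      Sum.elim (Quotient.mk s) (Quotient.mk s) y := by
    rintro (a | a)
    · exact Quotient.sound (s := s) (SameCycle.symm ⟨1, by simp⟩)
    · exact Quotient.sound (s := s) (⟨1, by simp⟩)
  have key1 : ∀ y : A ⊕ A, (Sum.elim (Quotient.mk s) (Quotient.mk s) (Js 1 y)) =
      Sum.elim (Quotient.mk s) (Quotient.mk s) y := by
    rintro (a | a) <;> rfl
  have r1 : ∀ x : V, (Quot.mk _ (F1 x) : Q2 F1 F2) = Quot.mk _ x :=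
    fun x => (Quot.sound (r := fun x y : V => y = F1 x ∨ y = F2 x) (Or.inl rfl)).symm
  have r2 : ∀ x : V, (Quot.mk _ (F2 x) : Q2 F1 F2) = Quot.mk _ x :=
    fun x => (Quot.sound (r := fun x y : V => y = F1 x ∨ y = F2 x) (Or.inr rfl)).symm
  have st : ∀ a : A, (Quot.mk _ (e.symm (Sum.inl (σ a))) : Q2 F1 F2) =
      Quot.mk _ (e.symm (Sum.inl a)) := by
    intro a
    rw [← r2 (e.symm (Sum.inl a)), ← r1 (F2 _)]
    congr 1
    rw [Equiv.symm_apply_eq, m.m1, m.m2]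
    simp [Js_inl, Js_inr]; rfl
  have st2 : ∀ (k : ℕ) (a : A), (Quot.mk _ (e.symm (Sum.inl ((σ ^ k) a))) : Q2 F1 F2) =
      Quot.mk _ (e.symm (Sum.inl a)) := by
    intro k a
    induction k with
    | zero => rfl
    | succ k ih => rw [pow_succ', mul_apply, st, ih]
  refine Nat.card_congr ⟨
    Quot.lift (fun x => Sum.elim (Quotient.mk s) (Quotient.mk s) (e x)) ?_,
    Quotient.lift (fun a => Quot.mk _ (e.symm (Sum.inl a))) ?_, ?_, ?_⟩
  · rintro x y (rfl | rfl)
    · rw [m.m1, key1]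
    · rw [m.m2, key]
  · intro a b hab
    obtain ⟨k, hk, -, rfl⟩ := SameCycle.exists_pow_eq' (f := σ) hab
    exact (st2 _ a).symm
  · rintro ⟨x⟩
    change Quotient.lift _ _ (Sum.elim (Quotient.mk s) (Quotient.mk s) (e x)) = Quot.mk _ x
    rcases hx : e x with a | a
    · change Quot.mk _ (e.symm (Sum.inl a)) = _
      rw [← hx]; simp
    · change Quot.mk _ (e.symm (Sum.inl a)) = _
      rw [← r1 x]
      congr 1
      rw [Equiv.symm_apply_eq, m.m1, hx]; rfl
  · intro q
    refine Quotient.inductionOn q (fun a => ?_)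
    change Sum.elim (Quotient.mk s) (Quotient.mk s) (e (e.symm (Sum.inl a))) = _
    simp [s]

lemma card_Q2 {F1 F2 : Perm V} (h1 : IsPerfectMatching F1) (h2 : IsPerfectMatching F2) :
    2 * Nat.card (Q2 F1 F2) + (F1 * F2).cycleType.sum =
      Fintype.card V + (F1 * F2).cycleType.card := by
  obtain ⟨c, c1, c2⟩ := exists_col h1 h2
  obtain ⟨τ, e, hτ, m⟩ := model1 h1 h2 c1 c2
  have := card_sameCycle τ
  rw [m.card_Q2, m.ct, m.card, Multiset.sum_add, Multiset.card_add]
  omega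

end
end HFH

namespace HFH
set_option linter.unusedSectionVars false
open Equiv Equiv.Perm

section
variable {V : Type*}

/-- functions invariant under two matchings -/
def I2 (F1 F2 : Perm V) : Submodule ℚ (V → ℚ) where
  carrier := {f | (∀ x, f (F1 x) = f x) ∧ ∀ x, f (F2 x) = f x}
  add_mem' := by
    rintro a b ⟨ha, ha'⟩ ⟨hb, hb'⟩
    exact ⟨fun x => by simp [ha, hb], fun x => by simp [ha', hb']⟩
  zero_mem' := by simp
  smul_mem' := by
    rintro r a ⟨ha, ha'⟩
    exact ⟨fun x => by simp [ha], fun x => by simp [ha']⟩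

/-- functions invariant under three matchings -/
def I3 (F1 F2 F3 : Perm V) : Submodule ℚ (V → ℚ) where
  carrier := {f | (∀ x, f (F1 x) = f x) ∧ (∀ x, f (F2 x) = f x) ∧ ∀ x, f (F3 x) = f x}
  add_mem' := by
    rintro a b ⟨ha, ha', ha''⟩ ⟨hb, hb', hb''⟩
    exact ⟨fun x => by simp [ha, hb], fun x => by simp [ha', hb'], fun x => by simp [ha'', hb'']⟩
  zero_mem' := by simp
  smul_mem' := by
    rintro r a ⟨ha, ha', ha''⟩
    exact ⟨fun x => by simp [ha], fun x => by simp [ha'], fun x => by simp [ha'']⟩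

/-- functions anti-invariant under three matchings -/
def W3 (F1 F2 F3 : Perm V) : Submodule ℚ (V → ℚ) where
  carrier := {f | (∀ x, f (F1 x) = - f x) ∧ (∀ x, f (F2 x) = - f x) ∧ ∀ x, f (F3 x) = - f x}
  add_mem' := by
    rintro a b ⟨ha, ha', ha''⟩ ⟨hb, hb', hb''⟩
    exact ⟨fun x => by simp [ha, hb, add_comm], fun x => by simp [ha', hb', add_comm],
      fun x => by simp [ha'', hb'', add_comm]⟩
  zero_mem' := by simp
  smul_mem' := by
    rintro r a ⟨ha, ha', ha''⟩
    exact ⟨fun x => by simp [ha], fun x => by simp [ha'], fun x => by simp [ha'']⟩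

/-- invariant functions are functions on the quotient -/
def I2equiv (F1 F2 : Perm V) : (Q2 F1 F2 → ℚ) ≃ₗ[ℚ] I2 F1 F2 where
  toFun g := ⟨fun x => g (Quot.mk _ x), by
    constructor
    · intro x
      exact congrArg g (Quot.sound (r := fun x y : V => y = F1 x ∨ y = F2 x) (Or.inl rfl)).symm
    · intro x
      exact congrArg g (Quot.sound (r := fun x y : V => y = F1 x ∨ y = F2 x) (Or.inr rfl)).symm⟩
  map_add' a b := rfl
  map_smul' a b := rfl
  invFun f := Quot.lift f.1 (by
    rintro x y (rfl | rfl)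
    · exact (f.2.1 x).symm
    · exact (f.2.2 x).symm)
  left_inv g := by ext ⟨x⟩; rfl
  right_inv f := rfl

/-- invariant functions are functions on the quotient -/
def I3equiv (F1 F2 F3 : Perm V) : (Q3 F1 F2 F3 → ℚ) ≃ₗ[ℚ] I3 F1 F2 F3 where
  toFun g := ⟨fun x => g (Quot.mk _ x), by
    refine ⟨?_, ?_, ?_⟩
    · intro x
      exact congrArg g (Quot.sound (r := fun x y : V => y = F1 x ∨ y = F2 x ∨ y = F3 x)
        (Or.inl rfl)).symm
    · intro x
      exact congrArg g (Quot.sound (r := fun x y : V => y = F1 x ∨ y = F2 x ∨ y = F3 x)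
        (Or.inr (Or.inl rfl))).symm
    · intro x
      exact congrArg g (Quot.sound (r := fun x y : V => y = F1 x ∨ y = F2 x ∨ y = F3 x)
        (Or.inr (Or.inr rfl))).symm⟩
  map_add' a b := rfl
  map_smul' a b := rfl
  invFun f := Quot.lift f.1 (by
    rintro x y (rfl | rfl | rfl)
    · exact (f.2.1 x).symm
    · exact (f.2.2.1 x).symm
    · exact (f.2.2.2 x).symm)
  left_inv g := by ext ⟨x⟩; rfl
  right_inv f := rfl

open Module in
lemma finrank_I2 [Finite V] (F1 F2 : Perm V) : finrank ℚ (I2 F1 F2) = Nat.card (Q2 F1 F2) := by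
  have := Fintype.ofFinite (Q2 F1 F2)
  rw [← (I2equiv F1 F2).finrank_eq, finrank_fintype_fun_eq_card, Nat.card_eq_fintype_card]

open Module in
lemma finrank_I3 [Finite V] (F1 F2 F3 : Perm V) :
    finrank ℚ (I3 F1 F2 F3) = Nat.card (Q3 F1 F2 F3) := by
  have := Fintype.ofFinite (Q3 F1 F2 F3)
  rw [← (I3equiv F1 F2 F3).finrank_eq, finrank_fintype_fun_eq_card, Nat.card_eq_fintype_card]

variable [Fintype V] [DecidableEq V]

lemma two_finrank_I {F : Perm V} (h : IsPerfectMatching F) :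
    2 * Module.finrank ℚ (I2 F F) = Fintype.card V := by
  rw [finrank_I2]
  have := card_Q2 h h
  rw [h.1] at this
  simpa using this

/-- the boundary map -/
def bd (F1 F2 F3 : Perm V) : (I2 F1 F2 × I2 F1 F3 × I2 F2 F3) →ₗ[ℚ]
    (I2 F1 F1 × I2 F2 F2 × I2 F3 F3) where
  toFun p := (⟨p.1.1 - p.2.1.1, by
      constructor <;> intro x <;> simp [p.1.2.1 x, p.2.1.2.1 x]⟩,
    ⟨p.2.2.1 - p.1.1, by
      constructor <;> intro x <;> simp [p.1.2.2 x, p.2.2.2.1 x]⟩,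
    ⟨p.2.1.1 - p.2.2.1, by
      constructor <;> intro x <;> simp [p.2.1.2.2 x, p.2.2.2.2 x]⟩)
  map_add' a b := by
    ext x <;> simp <;> ring
  map_smul' r a := by
    ext x <;> simp <;> ring

/-- the second boundary map -/
def bd1 (F1 F2 F3 : Perm V) : (I2 F1 F1 × I2 F2 F2 × I2 F3 F3) →ₗ[ℚ] (V → ℚ) :=
  (I2 F1 F1).subtype.coprod ((I2 F2 F2).subtype.coprod (I2 F3 F3).subtype)

lemma range_bd_le (F1 F2 F3 : Perm V) :
    LinearMap.range (bd F1 F2 F3) ≤ LinearMap.ker (bd1 F1 F2 F3) := by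
  rintro _ ⟨p, rfl⟩
  rw [LinearMap.mem_ker]
  ext x
  simp [bd, bd1]

open Module in
lemma ker_bd_le (F1 F2 F3 : Perm V) :
    finrank ℚ (LinearMap.ker (bd F1 F2 F3)) ≤ finrank ℚ (I3 F1 F2 F3) := by
  have hk : ∀ p : LinearMap.ker (bd F1 F2 F3),
      p.1.1.1 = p.1.2.1.1 ∧ p.1.2.2.1 = p.1.1.1 := by
    rintro ⟨p, hp⟩
    rw [LinearMap.mem_ker] at hp
    have h1 := congrArg (fun q => q.1.1) hp
    have h2 := congrArg (fun q => q.2.1.1) hp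
    exact ⟨sub_eq_zero.1 h1, sub_eq_zero.1 h2⟩
  let L : LinearMap.ker (bd F1 F2 F3) →ₗ[ℚ] I3 F1 F2 F3 :=
    { toFun := fun p => ⟨p.1.1.1, p.1.1.2.1, p.1.1.2.2, by
        rw [(hk p).1]; exact p.1.2.1.2.2⟩
      map_add' := fun a b => rfl
      map_smul' := fun a b => rfl }
  apply LinearMap.finrank_le_finrank_of_injective (f := L)
  intro p q hpq
  have h : p.1.1.1 = q.1.1.1 := by
    have := congrArg (fun z : I3 F1 F2 F3 => z.1) hpq
    exact this
  apply Subtype.ext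
  refine Prod.ext (Subtype.ext h) (Prod.ext (Subtype.ext ?_) (Subtype.ext ?_))
  · rw [← (hk p).1, ← (hk q).1, h]
  · rw [(hk p).2, (hk q).2, h]

open Module in
lemma card_le_range (F1 F2 F3 : Perm V) (h1 : IsPerfectMatching F1)
    (h2 : IsPerfectMatching F2) (h3 : IsPerfectMatching F3) :
    Fintype.card V ≤ finrank ℚ (LinearMap.range (bd1 F1 F2 F3)) + finrank ℚ (W3 F1 F2 F3) := by
  have h := Subspace.finrank_add_finrank_dualAnnihilator_eq (LinearMap.range (bd1 F1 F2 F3))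
  rw [finrank_fintype_fun_eq_card] at h
  rw [← h]
  have key : ∀ (F : Perm V), IsPerfectMatching F → ∀ x,
      (Pi.single x 1 + Pi.single (F x) 1 : V → ℚ) ∈ I2 F F := by
    intro F hF x
    have : ∀ y, (Pi.single x 1 + Pi.single (F x) 1 : V → ℚ) (F y) =
        (Pi.single x 1 + Pi.single (F x) 1 : V → ℚ) y := by
      intro y
      have e1 : F y = x ↔ y = F x := by
        constructor
        · rintro rfl; rw [PM_app hF]
        · rintro rfl; rw [PM_app hF]
      simp only [Pi.add_apply, Pi.single_apply, EmbeddingLike.apply_eq_iff_eq, e1]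
      ring
    exact ⟨this, this⟩
  have ann : ∀ φ ∈ (LinearMap.range (bd1 F1 F2 F3)).dualAnnihilator,
      (fun x => φ (Pi.single x 1)) ∈ W3 F1 F2 F3 := by
    intro φ hφ
    rw [Submodule.mem_dualAnnihilator] at hφ
    refine ⟨fun x => ?_, fun x => ?_, fun x => ?_⟩
    · have := hφ _ ⟨(⟨_, key F1 h1 x⟩, 0, 0), rfl⟩
      simp only [bd1, LinearMap.coprod_apply, Submodule.subtype_apply, map_zero, add_zero,
        map_add] at this
      linarith
    · have := hφ _ ⟨(0, ⟨_, key F2 h2 x⟩, 0), rfl⟩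
      simp only [bd1, LinearMap.coprod_apply, Submodule.subtype_apply, map_zero, add_zero,
        zero_add, map_add] at this
      linarith
    · have := hφ _ ⟨(0, 0, ⟨_, key F3 h3 x⟩), rfl⟩
      simp only [bd1, LinearMap.coprod_apply, Submodule.subtype_apply, map_zero, add_zero,
        zero_add, map_add] at this
      linarith
  let L : (LinearMap.range (bd1 F1 F2 F3)).dualAnnihilator →ₗ[ℚ] W3 F1 F2 F3 :=
    { toFun := fun φ => ⟨_, ann φ.1 φ.2⟩
      map_add' := fun a b => rfl
      map_smul' := fun a b => rfl }
  have : finrank ℚ (LinearMap.range (bd1 F1 F2 F3)).dualAnnihilator ≤ finrank ℚ (W3 F1 F2 F3) := by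
    apply LinearMap.finrank_le_finrank_of_injective (f := L)
    intro φ ψ hh
    have h : ∀ x, φ.1 (Pi.single x 1) = ψ.1 (Pi.single x 1) :=
      fun x => congrFun (congrArg Subtype.val hh) x
    apply Subtype.ext
    apply LinearMap.pi_ext'
    intro x
    ext
    exact h x
  omega

open Module in
lemma euler {F1 F2 F3 : Perm V} (h1 : IsPerfectMatching F1)
    (h2 : IsPerfectMatching F2) (h3 : IsPerfectMatching F3) :
    2 * (Nat.card (Q2 F1 F2) + Nat.card (Q2 F1 F3) + Nat.card (Q2 F2 F3)) ≤
      Fintype.card V + 2 * Nat.card (Q3 F1 F2 F3) + 2 * finrank ℚ (W3 F1 F2 F3) := by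
  have a1 := LinearMap.finrank_range_add_finrank_ker (bd F1 F2 F3)
  have a2 := LinearMap.finrank_range_add_finrank_ker (bd1 F1 F2 F3)
  have a3 := Submodule.finrank_mono (range_bd_le F1 F2 F3)
  have a4 := ker_bd_le F1 F2 F3
  have a5 := card_le_range F1 F2 F3 h1 h2 h3
  rw [finrank_prod, finrank_prod] at a1 a2
  have b1 := two_finrank_I h1
  have b2 := two_finrank_I h2
  have b3 := two_finrank_I h3
  rw [finrank_I3] at a4
  rw [finrank_I2 F1 F2, finrank_I2 F1 F3, finrank_I2 F2 F3] at a1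
  omega

open Module in
lemma W3_le (F1 F2 F3 : Perm V) :
    finrank ℚ (W3 F1 F2 F3) ≤ Nat.card (Q3 F1 F2 F3) ∧
    (finrank ℚ (W3 F1 F2 F3) = Nat.card (Q3 F1 F2 F3) →
      ∃ c : V → Bool, Resp c F1 ∧ Resp c F2 ∧ Resp c F3) := by
  classical
  rw [← finrank_I3]
  have hex : ∃ n, ∃ f ∈ W3 F1 F2 F3, (Finset.univ.filter fun x => f x = 0).card = n :=
    ⟨_, 0, Submodule.zero_mem _, rfl⟩
  obtain ⟨f, hf, hcard⟩ := Nat.find_spec hex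
  have hmax : ∀ f' ∈ W3 F1 F2 F3, ∀ x, f x = 0 → f' x = 0 := by
    intro f' hf' x hx
    by_contra hne
    have hg : (fun y => f y + if f y = 0 then f' y else 0) ∈ W3 F1 F2 F3 := by
      refine ⟨fun y => ?_, fun y => ?_, fun y => ?_⟩
      · simp only [hf.1 y, hf'.1 y, neg_eq_zero]
        split_ifs <;> ring
      · simp only [hf.2.1 y, hf'.2.1 y, neg_eq_zero]
        split_ifs <;> ring
      · simp only [hf.2.2 y, hf'.2.2 y, neg_eq_zero]
        split_ifs <;> ring
    have hlt : (Finset.univ.filter fun y => (f y + if f y = 0 then f' y else 0) = 0).card <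
        (Finset.univ.filter fun x => f x = 0).card := by
      apply Finset.card_lt_card
      rw [Finset.ssubset_iff_of_subset]
      · refine ⟨x, by simp [hx], by simp [hx, hne]⟩
      · intro y
        simp only [Finset.mem_filter, Finset.mem_univ, true_and]
        intro hy
        by_contra h0
        simp [h0] at hy
    rw [hcard] at hlt
    exact Nat.find_min hex hlt ⟨_, hg, rfl⟩
  let L : W3 F1 F2 F3 →ₗ[ℚ] I3 F1 F2 F3 :=
    { toFun := fun g => ⟨fun x => f x * g.1 x, by
        refine ⟨fun y => ?_, fun y => ?_, fun y => ?_⟩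
        · change f _ * g.1 _ = f y * g.1 y
          rw [hf.1 y, g.2.1 y]; ring
        · change f _ * g.1 _ = f y * g.1 y
          rw [hf.2.1 y, g.2.2.1 y]; ring
        · change f _ * g.1 _ = f y * g.1 y
          rw [hf.2.2 y, g.2.2.2 y]; ring⟩
      map_add' := fun a b => by ext x; simp; ring
      map_smul' := fun a b => by ext x; simp; ring }
  have hL : Function.Injective L := by
    rw [← LinearMap.ker_eq_bot, LinearMap.ker_eq_bot']
    intro g hg
    ext x
    have : f x * g.1 x = 0 := congrFun (congrArg Subtype.val hg) x
    rcases mul_eq_zero.1 this with h | h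
    · exact hmax _ g.2 x h
    · exact h
  refine ⟨LinearMap.finrank_le_finrank_of_injective hL, fun heq => ?_⟩
  have hs := (LinearMap.injective_iff_surjective_of_finrank_eq_finrank heq).1 hL
  obtain ⟨g, hg⟩ := hs ⟨fun _ => 1, fun _ => rfl, fun _ => rfl, fun _ => rfl⟩
  have hne : ∀ x, f x ≠ 0 := by
    intro x hx
    have : f x * g.1 x = 1 := congrFun (congrArg Subtype.val hg) x
    rw [hx] at this; simp at this
  have key : ∀ y : ℚ, y ≠ 0 → decide (0 < -y) = !decide (0 < y) := by
    intro y hy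
    rcases lt_or_gt_of_ne hy with h | h
    · simp [h, h.le]
    · simp [h, h.le]
  refine ⟨fun x => decide (0 < f x), fun x => ?_, fun x => ?_, fun x => ?_⟩
  · simp only [hf.1 x]; exact key _ (hne x)
  · simp only [hf.2.1 x]; exact key _ (hne x)
  · simp only [hf.2.2 x]; exact key _ (hne x)

end
end HFH

namespace HFH
set_option linter.unusedSectionVars false
open Equiv Equiv.Perm

section
variable {V : Type*}

lemma card_col (r : V → V → Prop) (c0 : V → Bool) (h0 : ∀ x y, r x y → c0 y = !c0 x) [Finite V] :
    Nat.card {c : V → Bool // ∀ x y, r x y → c y = !c x} = 2 ^ Nat.card (Quot r) := by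
  have : Nat.card (Quot r → Bool) = 2 ^ Nat.card (Quot r) := by
    rw [Nat.card_fun]; simp
  rw [← this]
  refine Nat.card_congr ⟨fun c => Quot.lift (fun x => xor (c0 x) (c.1 x)) ?_,
    fun g => ⟨fun x => xor (c0 x) (g (Quot.mk _ x)), ?_⟩, ?_, ?_⟩
  · intro x y hxy
    simp only [h0 x y hxy, c.2 x y hxy]
    cases c0 x <;> cases c.1 x <;> rfl
  · intro x y hxy
    simp only [h0 x y hxy, Quot.sound hxy]
    cases c0 x <;> cases g (Quot.mk r y) <;> rfl
  · intro c
    apply Subtype.ext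
    funext x
    change xor (c0 x) (xor (c0 x) (c.1 x)) = c.1 x
    simp
  · intro g
    funext q
    induction q using Quot.ind with
    | mk x =>
      change xor (c0 x) (xor (c0 x) (g (Quot.mk _ x))) = _
      simp

lemma card_col2 [Finite V] {F1 F2 : Perm V} {c0 : V → Bool} (h1 : Resp c0 F1) (h2 : Resp c0 F2) :
    Nat.card {c : V → Bool // Resp c F1 ∧ Resp c F2} = 2 ^ Nat.card (Q2 F1 F2) := by
  rw [← card_col (fun x y : V => y = F1 x ∨ y = F2 x) c0]
  · apply Nat.card_congr
    apply Equiv.subtypeEquivRight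
    intro c
    constructor
    · rintro ⟨a, b⟩ x y (rfl | rfl)
      · exact a x
      · exact b x
    · intro h
      exact ⟨fun x => h _ _ (Or.inl rfl), fun x => h _ _ (Or.inr rfl)⟩
  · rintro x y (rfl | rfl)
    · exact h1 x
    · exact h2 x

lemma card_col3 [Finite V] {F1 F2 F3 : Perm V} {c0 : V → Bool} (h1 : Resp c0 F1)
    (h2 : Resp c0 F2) (h3 : Resp c0 F3) :
    Nat.card {c : V → Bool // Resp c F1 ∧ Resp c F2 ∧ Resp c F3}
      = 2 ^ Nat.card (Q3 F1 F2 F3) := by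
  rw [← card_col (fun x y : V => y = F1 x ∨ y = F2 x ∨ y = F3 x) c0]
  · apply Nat.card_congr
    apply Equiv.subtypeEquivRight
    intro c
    constructor
    · rintro ⟨a, b, d⟩ x y (rfl | rfl | rfl)
      · exact a x
      · exact b x
      · exact d x
    · intro h
      exact ⟨fun x => h _ _ (Or.inl rfl), fun x => h _ _ (Or.inr (Or.inl rfl)),
        fun x => h _ _ (Or.inr (Or.inr rfl))⟩
  · rintro x y (rfl | rfl | rfl)
    · exact h1 x
    · exact h2 x
    · exact h3 x

/-- no common edge of the three matchings -/
def Ex (F1 F2 F3 : Perm V) : Prop := ∀ x, F1 x = F2 x → F3 x ≠ F1 x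

lemma class_triv {F1 F2 : Perm V} (h1 : IsPerfectMatching F1) (h2 : IsPerfectMatching F2)
    {x y : V} (hx : F1 x = F2 x)
    (h : (Quot.mk _ y : Q2 F1 F2) = Quot.mk _ x) : y = x ∨ y = F1 x := by
  have k1 : ∀ z, (z = x ∨ z = F1 x) → (F1 z = x ∨ F1 z = F1 x) := by
    rintro z (rfl | rfl)
    · exact Or.inr rfl
    · exact Or.inl (PM_app h1 x)
  have k2 : ∀ z, (z = x ∨ z = F1 x) → (F2 z = x ∨ F2 z = F1 x) := by
    rintro z (rfl | rfl)
    · exact Or.inr hx.symm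
    · left; rw [hx, PM_app h2]
  let P : Q2 F1 F2 → Prop := Quot.lift (fun z => z = x ∨ z = F1 x) (by
    rintro a b (rfl | rfl)
    · apply propext
      exact ⟨k1 a, fun h => by simpa [PM_app h1] using k1 _ h⟩
    · apply propext
      exact ⟨k2 a, fun h => by simpa [PM_app h2] using k2 _ h⟩)
  have : P (Quot.mk _ y) := by rw [h]; exact Or.inl rfl
  exact this

variable [Fintype V] [DecidableEq V]

lemma exact_ineq {F1 F2 F3 : Perm V} (h1 : IsPerfectMatching F1) (h2 : IsPerfectMatching F2)
    (h3 : IsPerfectMatching F3) (hex : Ex F1 F2 F3) :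
    4 * Nat.card (Q3 F1 F2 F3) + Fintype.card V ≤
      4 * Nat.card (Q2 F1 F2) + (F1 * F2).cycleType.sum := by
  classical
  have := Fintype.ofFinite (Q2 F1 F2)
  have := Fintype.ofFinite (Q3 F1 F2 F3)
  let T : Finset V := Finset.univ.filter fun x => F1 x = F2 x
  let mk : V → Q2 F1 F2 := Quot.mk _
  let N : Finset (Q2 F1 F2) := T.image mk
  have hT : T.card + (F1 * F2).cycleType.sum = Fintype.card V := by
    rw [sum_cycleType]
    have := Finset.card_filter_add_card_filter_not (s := (Finset.univ : Finset V))
      (fun x => F1 x = F2 x)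
    rw [Finset.card_univ] at this
    rw [← this]; congr 2
    ext x
    simp only [mem_support, Finset.mem_filter, Finset.mem_univ, true_and, mul_apply, ne_eq]
    rw [not_iff_not]
    constructor
    · intro h; rw [← h, PM_app h1, h]
    · intro h; rw [← h, PM_app h1]
  have hN : T.card ≤ 2 * N.card := by
    apply Finset.card_le_mul_card_image
    intro q hq
    obtain ⟨x, hx, rfl⟩ := Finset.mem_image.1 hq
    have hx' : F1 x = F2 x := by simpa [T] using hx
    calc _ ≤ ({x, F1 x} : Finset V).card := by
          apply Finset.card_le_card
          intro y hy
          have hy' : mk y = mk x := (Finset.mem_filter.1 hy).2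
          rcases class_triv h1 h2 hx' hy' with h | h <;> simp [h]
      _ ≤ 2 := Finset.card_le_two
  let pr : Q2 F1 F2 → Q3 F1 F2 F3 := Quot.lift (fun x => Quot.mk _ x) (by
    rintro x y (h | h)
    · exact Quot.sound (r := fun x y : V => y = F1 x ∨ y = F2 x ∨ y = F3 x) (Or.inl h)
    · exact Quot.sound (r := fun x y : V => y = F1 x ∨ y = F2 x ∨ y = F3 x) (Or.inr (Or.inl h)))
  have e1 : (Finset.univ : Finset (Q2 F1 F2)).card =
      ∑ y : Q3 F1 F2 F3, ((Finset.univ : Finset (Q2 F1 F2)).filter fun q => pr q = y).card :=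
    Finset.card_eq_sum_card_fiberwise (by intro x _; simp)
  have e2 : N.card = ∑ y : Q3 F1 F2 F3, (N.filter fun q => pr q = y).card :=
    Finset.card_eq_sum_card_fiberwise (by intro x _; simp)
  have key : ∀ y : Q3 F1 F2 F3, 2 + (N.filter fun q => pr q = y).card ≤
      2 * ((Finset.univ : Finset (Q2 F1 F2)).filter fun q => pr q = y).card := by
    intro y
    have hsub : (N.filter fun q => pr q = y) ⊆
      ((Finset.univ : Finset (Q2 F1 F2)).filter fun q => pr q = y) :=
      Finset.filter_subset_filter _ (Finset.subset_univ _)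
    obtain ⟨x, rfl⟩ := Quot.exists_rep y
    by_cases hh : (N.filter fun q => pr q = Quot.mk _ x) =
      ((Finset.univ : Finset (Q2 F1 F2)).filter fun q => pr q = Quot.mk _ x)
    · rw [hh]
      have m1 : mk x ∈ ((Finset.univ : Finset (Q2 F1 F2)).filter fun q => pr q = Quot.mk _ x) := by
        simp [mk, pr]
      have m2 : mk (F3 x) ∈
          ((Finset.univ : Finset (Q2 F1 F2)).filter fun q => pr q = Quot.mk _ x) := by
        simp only [Finset.mem_filter, Finset.mem_univ, true_and]
        exact (Quot.sound (r := fun x y : V => y = F1 x ∨ y = F2 x ∨ y = F3 x)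
          (Or.inr (Or.inr rfl))).symm
      have m3 : mk x ≠ mk (F3 x) := by
        intro he
        rw [← hh] at m1
        obtain ⟨z, hz, hzx⟩ := Finset.mem_image.1 (Finset.mem_filter.1 m1).1
        have hz' : F1 z = F2 z := by simpa [T] using hz
        have c1 := class_triv h1 h2 hz' hzx.symm
        have c2 := class_triv h1 h2 hz' (he.symm.trans hzx.symm)
        have n1 := h3.2 x
        have n2 := hex z hz'
        have n3 := hex (F1 z) (by rw [PM_app h1, hz', PM_app h2])
        have n4 := PM_app h1 z
        grind
      have : 1 < ((Finset.univ : Finset (Q2 F1 F2)).filter fun q => pr q = Quot.mk _ x).card :=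
        Finset.one_lt_card.2 ⟨_, m1, _, m2, m3⟩
      omega
    · have := Finset.card_lt_card (hsub.ssubset_of_ne hh)
      omega
  have hs := Finset.sum_le_sum (fun y (_ : y ∈ (Finset.univ : Finset (Q3 F1 F2 F3))) => key y)
  rw [Finset.sum_add_distrib, ← Finset.mul_sum, ← e1, ← e2] at hs
  simp only [Finset.sum_const, Finset.card_univ, smul_eq_mul] at hs
  rw [Nat.card_eq_fintype_card, Nat.card_eq_fintype_card]
  omega

/-- the counted matchings -/
structure Good (μ ν : Multiset ℕ) (F1 F2 F3 : Perm V) : Prop where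
  pm : IsPerfectMatching F3
  t1 : (F1 * F3).cycleType = μ + μ
  t2 : (F2 * F3).cycleType = ν + ν

lemma deg_main {μ ν π : Multiset ℕ} (hμ : μ.card ≤ μ.sum) (hν : ν.card ≤ ν.sum)
    (hπ : π.card ≤ π.sum)
    (hle : π.sum - π.card ≤ (μ.sum - μ.card) + (ν.sum - ν.card)) {k : ℕ}
    {F1 F2 F3 : Perm V} (h1 : IsPerfectMatching F1) (h2 : IsPerfectMatching F2)
    (ht : (F1 * F2).cycleType = π + π) (hc : Fintype.card V = 2 * (π.sum + k))
    (g : Good μ ν F1 F2 F3) (hex : Ex F1 F2 F3) :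
    k ≤ (μ.sum - μ.card) + (ν.sum - ν.card) - (π.sum - π.card) ∧
    (k = (μ.sum - μ.card) + (ν.sum - ν.card) - (π.sum - π.card) →
      2 * Nat.card (Q3 F1 F2 F3) + k = 2 * Nat.card (Q2 F1 F2) ∧
      ∃ c : V → Bool, Resp c F1 ∧ Resp c F2 ∧ Resp c F3) := by
  have a1 := card_Q2 h1 h2
  have a2 := card_Q2 h1 g.pm
  have a3 := card_Q2 h2 g.pm
  have a4 := exact_ineq h1 h2 g.pm hex
  have a5 := euler h1 h2 g.pm
  obtain ⟨a6, a7⟩ := W3_le F1 F2 F3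
  rw [ht] at a1 a4
  rw [g.t1] at a2
  rw [g.t2] at a3
  rw [Multiset.sum_add] at a1 a2 a3 a4
  rw [Multiset.card_add] at a1 a2 a3
  refine ⟨by omega, fun hk => ⟨by omega, a7 (by omega)⟩⟩

/-- number of exact matchings -/
noncomputable def cnt (μ ν : Multiset ℕ) (F1 F2 : Perm V) (c : V → Bool) (R : Prop) : ℕ :=
  Nat.card {F3 : Perm V // Good μ ν F1 F2 F3 ∧ (R → Resp c F3) ∧ Ex F1 F2 F3}

lemma Mod.cnt_eq {A : Type*} [Fintype A] [DecidableEq A] {μ ν : Multiset ℕ}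
    {F1 F2 : Perm V} {c : V → Bool} {σ : Perm A} {e : V ≃ A ⊕ A}
    (m : Mod F1 F2 c σ e) (R : Prop) :
    cnt μ ν F1 F2 c R = cnt μ ν (Js 1) (Js σ) Sum.isLeft R := by
  apply Nat.card_congr
  refine Equiv.subtypeEquiv e.permCongr ?_
  intro F3
  have e1 : e.permCongr F1 = Js 1 := by
    ext x : 1; simp [Equiv.permCongr_apply, m.m1]
  have e2 : e.permCongr F2 = Js σ := by
    ext x : 1; simp [Equiv.permCongr_apply, m.m2]
  have p1 : (Js 1 * e.permCongr F3).cycleType = (F1 * F3).cycleType := by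
    rw [← e1, ← ct_permCongr e (F1 * F3)]; congr 1
    ext x : 1; simp [Equiv.permCongr_apply]
  have p2 : (Js σ * e.permCongr F3).cycleType = (F2 * F3).cycleType := by
    rw [← e2, ← ct_permCongr e (F2 * F3)]; congr 1
    ext x : 1; simp [Equiv.permCongr_apply]
  have pm : IsPerfectMatching F3 ↔ IsPerfectMatching (e.permCongr F3) := by
    unfold IsPerfectMatching
    constructor
    · rintro ⟨a, b⟩
      refine ⟨?_, fun x => ?_⟩
      · ext x : 1
        have := PM_app (F := F3) ⟨a, b⟩
        simp [Equiv.permCongr_apply, this]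
      · intro h
        apply b (e.symm x)
        rw [← Equiv.symm_apply_eq, Equiv.symm_symm] at *
        simpa [Equiv.permCongr_apply] using h
    · rintro ⟨a, b⟩
      refine ⟨?_, fun x => ?_⟩
      · ext x : 1
        have := PM_app (F := e.permCongr F3) ⟨a, b⟩ (e x)
        simpa [Equiv.permCongr_apply] using this
      · intro h
        apply b (e x)
        simp [Equiv.permCongr_apply, h]
  have rr : Resp c F3 ↔ Resp Sum.isLeft (e.permCongr F3) := by
    constructor
    · intro h x
      have := h (e.symm x)
      rw [← m.mc, ← m.mc] at this
      simpa [Equiv.permCongr_apply] using this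
    · intro h x
      have := h (e x)
      rw [← m.mc, ← m.mc]
      simpa [Equiv.permCongr_apply] using this
  have ee : Ex F1 F2 F3 ↔ Ex (Js 1) (Js σ) (e.permCongr F3) := by
    rw [← e1, ← e2]
    constructor
    · intro h x hx
      have := h (e.symm x)
      simp only [Equiv.permCongr_apply, EmbeddingLike.apply_eq_iff_eq, ne_eq] at hx ⊢
      exact this hx
    · intro h x hx
      have := h (e x)
      simp only [Equiv.permCongr_apply, EmbeddingLike.apply_eq_iff_eq, ne_eq,
        Equiv.symm_apply_apply] at this
      exact this hx
  constructor
  · rintro ⟨g, r, x⟩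
    exact ⟨⟨pm.1 g.pm, p1.trans g.t1, p2.trans g.t2⟩, fun hR => rr.1 (r hR), ee.1 x⟩
  · rintro ⟨g, r, x⟩
    exact ⟨⟨pm.2 g.pm, p1.symm.trans g.t1, p2.symm.trans g.t2⟩, fun hR => rr.2 (r hR), ee.2 x⟩

end
end HFH

namespace HFH
set_option linter.unusedSectionVars false
open Equiv Equiv.Perm

section
variable {V : Type*} [Fintype V] [DecidableEq V]

lemma restrict_cnt {μ ν : Multiset ℕ} {F1 F2 : Perm V} {c : V → Bool}
    (h1 : IsPerfectMatching F1) (c1 : Resp c F1) (R : Prop)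
    (h2 : IsPerfectMatching F2)
    (p : V → Prop) [DecidablePred p] (hp1 : ∀ x, p (F1 x) ↔ p x) (hp2 : ∀ x, p (F2 x) ↔ p x)
    (hoff : ∀ x, ¬ p x → F1 x = F2 x) :
    Nat.card {F3 : Perm V // (Good μ ν F1 F2 F3 ∧ (R → Resp c F3)) ∧
      (∀ x, ¬ p x → F3 x = F1 x) ∧ (∀ x, p x → F1 x = F2 x → F3 x ≠ F1 x)} =
    cnt μ ν (F1.subtypePerm hp1) (F2.subtypePerm hp2) (fun x => c x.1) R := by
  set f1 := F1.subtypePerm hp1 with hf1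
  set f2 := F2.subtypePerm hp2 with hf2
  let Φ : Perm (Subtype p) → Perm V := fun G => F1 * ofSubtype (f1 * G)
  have Φon : ∀ G (x : Subtype p), Φ G x.1 = (G x).1 := by
    intro G x
    simp only [Φ, mul_apply, ofSubtype_apply_coe]
    rw [hf1, subtypePerm_apply]
    exact PM_app h1 _
  have Φoff : ∀ G x, ¬ p x → Φ G x = F1 x := by
    intro G x hx
    simp only [Φ, mul_apply, ofSubtype_apply_of_not_mem _ hx]
  have m1 : ∀ G, F1 * Φ G = ofSubtype (f1 * G) := by
    intro G
    simp only [Φ]; rw [← mul_assoc, h1.1, one_mul]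
  have m2 : ∀ G, F2 * Φ G = ofSubtype (f2 * G) := by
    intro G
    ext x
    by_cases hx : p x
    · have := Φon G ⟨x, hx⟩
      rw [ofSubtype_apply_of_mem _ hx]
      exact congrArg F2 this
    · rw [ofSubtype_apply_of_not_mem _ hx, mul_apply, Φoff G x hx, hoff x hx, PM_app h2]
  have pm : ∀ G, IsPerfectMatching (Φ G) ↔ IsPerfectMatching G := by
    intro G
    constructor
    · intro h
      refine ⟨?_, fun x hx => h.2 x.1 (by rw [Φon, hx])⟩
      ext x
      have := PM_app h x.1
      rw [Φon, Φon] at this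
      simpa using this
    · intro h
      constructor
      · ext x
        by_cases hx : p x
        · have a := Φon G ⟨x, hx⟩
          have b := Φon G (G ⟨x, hx⟩)
          rw [mul_apply, a, b, PM_app h]; rfl
        · rw [mul_apply, Φoff G x hx, Φoff G _ (by rw [hp1]; exact hx), PM_app h1]; rfl
      · intro x
        by_cases hx : p x
        · have a := Φon G ⟨x, hx⟩
          rw [a]
          intro hh
          exact h.2 ⟨x, hx⟩ (Subtype.ext hh)
        · rw [Φoff G x hx]; exact h1.2 x
  have good : ∀ G, Good μ ν F1 F2 (Φ G) ↔ Good μ ν f1 f2 G := by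
    intro G
    have t1 : (F1 * Φ G).cycleType = (f1 * G).cycleType := by rw [m1, cycleType_ofSubtype]
    have t2 : (F2 * Φ G).cycleType = (f2 * G).cycleType := by rw [m2, cycleType_ofSubtype]
    constructor
    · rintro ⟨a, b, d⟩
      exact ⟨(pm G).1 a, t1 ▸ b, t2 ▸ d⟩
    · rintro ⟨a, b, d⟩
      exact ⟨(pm G).2 a, t1.trans b, t2.trans d⟩
  have resp : ∀ G, Resp c (Φ G) ↔ Resp (fun x : Subtype p => c x.1) G := by
    intro G
    constructor
    · intro h x
      have := h x.1
      rwa [Φon] at this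
    · intro h x
      by_cases hx : p x
      · have a := Φon G ⟨x, hx⟩
        rw [a]; exact h ⟨x, hx⟩
      · rw [Φoff G x hx]; exact c1 x
  have ex : ∀ G, (∀ x, p x → F1 x = F2 x → Φ G x ≠ F1 x) ↔ Ex f1 f2 G := by
    intro G
    constructor
    · intro h x hx hx'
      have hx2 := congrArg Subtype.val hx
      have hx2' := congrArg Subtype.val hx'
      exact h x.1 x.2 hx2 (by rw [Φon]; exact hx2')
    · intro h x hx he hh
      have a := Φon G ⟨x, hx⟩
      rw [a] at hh
      exact h ⟨x, hx⟩ (Subtype.ext he) (Subtype.ext hh)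
  symm
  apply Nat.card_eq_of_bijective
    (fun G => ⟨Φ G.1, ⟨(good _).2 G.2.1, fun hR => (resp _).2 (G.2.2.1 hR)⟩, Φoff _,
      (ex _).2 G.2.2.2⟩)
  constructor
  · intro G G' h
    have h' : Φ G.1 = Φ G'.1 := congrArg Subtype.val h
    apply Subtype.ext
    exact mul_left_cancel (ofSubtype_injective (mul_left_cancel h'))
  · rintro ⟨F3, ⟨g, r⟩, off, e⟩
    have hp3' : ∀ x, ¬ p x → ¬ p (F3 x) := by
      intro x hx; rw [off x hx, hp1]; exact hx
    have hp3 : ∀ x, p (F3 x) ↔ p x := by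
      intro x
      constructor
      · intro h; by_contra hx; exact hp3' x hx h
      · intro h; by_contra hx
        have := hp3' _ hx
        rw [PM_app g.pm] at this
        exact this h
    have hΦ : Φ (F3.subtypePerm hp3) = F3 := by
      ext x
      by_cases hx : p x
      · exact Φon _ ⟨x, hx⟩
      · rw [Φoff _ _ hx, off x hx]
    rw [← hΦ] at g r e
    exact ⟨⟨F3.subtypePerm hp3, (good _).1 g, fun hR => (resp _).1 (r hR), (ex _).1 e⟩,
      Subtype.ext hΦ⟩

/-- the positive common points -/
def Tp (F1 F2 : Perm V) (c : V → Bool) : Finset V :=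
  Finset.univ.filter fun x => F1 x = F2 x ∧ c x = true

/-- the restricted vertex set -/
def Pd (F1 F2 : Perm V) (D : Finset V) (x : V) : Prop := F1 x ≠ F2 x ∨ x ∈ D ∨ F1 x ∈ D

instance (F1 F2 : Perm V) (D : Finset V) : DecidablePred (Pd F1 F2 D) :=
  fun _ => inferInstanceAs (Decidable (_ ∨ _ ∨ _))

lemma card_Pd {F1 F2 : Perm V} {c : V → Bool}
    (h1 : IsPerfectMatching F1) (c1 : Resp c F1) {D : Finset V} (hD : D ⊆ Tp F1 F2 c)
    (h2 : IsPerfectMatching F2) :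
    Fintype.card {x // Pd F1 F2 D x} = (F1 * F2).cycleType.sum + 2 * D.card := by
  have hD' : ∀ x ∈ D, F1 x = F2 x ∧ c x = true := fun x hx => by simpa [Tp] using hD hx
  rw [Fintype.card_subtype]
  have e : (Finset.univ.filter fun x => Pd F1 F2 D x) =
      (F1 * F2).support ∪ (D ∪ D.image F1) := by
    ext x
    rw [Finset.mem_filter]
    simp only [Finset.mem_univ, true_and, Finset.mem_union, mem_support,
      Finset.mem_image, mul_apply]
    unfold Pd
    refine or_congr (not_congr ?_) (or_congr Iff.rfl ?_)
    · constructor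
      · intro h; rw [← h, PM_app h1]
      · intro h; rw [← h, PM_app h1, h]
    · constructor
      · intro h; exact ⟨_, h, PM_app h1 x⟩
      · rintro ⟨a, ha, rfl⟩; rwa [PM_app h1]
  have d1 : Disjoint D (D.image F1) := by
    rw [Finset.disjoint_left]
    intro x hx hx'
    obtain ⟨y, hy, rfl⟩ := Finset.mem_image.1 hx'
    have := (hD' _ hx).2
    rw [c1 y, (hD' y hy).2] at this
    simp at this
  have d2 : Disjoint (F1 * F2).support (D ∪ D.image F1) := by
    rw [Finset.disjoint_right]
    intro x hx
    rw [mem_support, not_not, mul_apply]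
    rcases Finset.mem_union.1 hx with h | h
    · rw [← (hD' _ h).1, PM_app h1]
    · obtain ⟨y, hy, rfl⟩ := Finset.mem_image.1 h
      have h3 := (hD' _ hy).1
      rw [h3, PM_app h2, ← h3]
  rw [e, Finset.card_union_of_disjoint d2, Finset.card_union_of_disjoint d1,
    Finset.card_image_of_injective _ F1.injective, sum_cycleType]
  ring

lemma card_Tp {F1 F2 : Perm V} {c : V → Bool}
    (h1 : IsPerfectMatching F1) (c1 : Resp c F1) (h2 : IsPerfectMatching F2) :
    Fintype.card V = (F1 * F2).cycleType.sum + 2 * (Tp F1 F2 c).card := by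
  rw [← card_Pd h1 c1 (Finset.Subset.refl _) h2]
  symm
  apply Fintype.card_congr
  apply Equiv.subtypeUnivEquiv
  intro x
  by_cases h : F1 x = F2 x
  · right
    by_cases hc : c x = true
    · left; simp [Tp, h, hc]
    · right
      have : F1 (F1 x) = F2 (F1 x) := by rw [PM_app h1, h, PM_app h2]
      simp only [Tp, Finset.mem_filter, Finset.mem_univ, true_and, this, c1 x]
      simpa using hc
  · exact Or.inl h

lemma total {μ ν π : Multiset ℕ} {F1 F2 : Perm V} {c : V → Bool} (R : Prop)
    (h1 : IsPerfectMatching F1) (h2 : IsPerfectMatching F2) (c1 : Resp c F1) (c2 : Resp c F2)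
    (ht : (F1 * F2).cycleType = π + π) (σ : ∀ k, Perm (Fin (π.sum + k)))
    (hσ : ∀ k, (σ k).cycleType = π) :
    Nat.card {F3 : Perm V // Good μ ν F1 F2 F3 ∧ (R → Resp c F3)} =
      ∑ k ∈ Finset.range ((Tp F1 F2 c).card + 1),
        (Tp F1 F2 c).card.choose k * cnt μ ν (Js 1) (Js (σ k)) Sum.isLeft R := by
  classical
  have h := Finset.sum_powerset_apply_card
    (fun k => cnt μ ν (Js 1) (Js (σ k)) Sum.isLeft R) (x := Tp F1 F2 c)
  simp only [smul_eq_mul] at h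
  rw [← h, Nat.card_eq_fintype_card, Fintype.card_subtype]
  let Df : Perm V → Finset V := fun F3 => Finset.univ.filter fun x =>
    (F1 x = F2 x ∧ c x = true) ∧ F3 x ≠ F1 x
  rw [Finset.card_eq_sum_card_fiberwise (f := Df) (t := (Tp F1 F2 c).powerset)]
  swap
  · intro F3 _
    simp only [Finset.coe_powerset, Set.mem_preimage, Set.mem_powerset_iff, Finset.coe_subset]
    intro x hx
    simp only [Df, Finset.mem_filter] at hx
    simp only [Tp, Finset.mem_filter]
    exact ⟨hx.1, hx.2.1⟩
  apply Finset.sum_congr rfl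
  intro D hDp
  have hD := Finset.mem_powerset.1 hDp
  have hD' : ∀ x ∈ D, F1 x = F2 x ∧ c x = true := fun x hx => by simpa [Tp] using hD hx
  have com : ∀ {x}, F1 x = F2 x → F1 (F1 x) = F2 (F1 x) := by
    intro x h; rw [PM_app h1, h, PM_app h2]
  have hp1 : ∀ x, Pd F1 F2 D (F1 x) ↔ Pd F1 F2 D x := by
    intro x
    have : F1 (F1 x) ≠ F2 (F1 x) ↔ F1 x ≠ F2 x := by
      apply not_congr
      constructor
      · intro h
        rw [PM_app h1] at h
        calc F1 x = F2 (F2 (F1 x)) := (PM_app h2 _).symm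
          _ = F2 x := by rw [← h]
      · exact com
    unfold Pd
    rw [this, PM_app h1, or_comm (a := F1 x ∈ D)]
  have hp2 : ∀ x, Pd F1 F2 D (F2 x) ↔ Pd F1 F2 D x := by
    intro x
    by_cases h : F1 x = F2 x
    · rw [← h]; exact hp1 x
    · have : F1 (F2 x) ≠ F2 (F2 x) := by
        intro h'
        rw [PM_app h2] at h'
        apply h
        rw [← h', PM_app h1, h']
      constructor
      · intro _; exact Or.inl h
      · intro _; exact Or.inl this
  have hoff : ∀ x, ¬ Pd F1 F2 D x → F1 x = F2 x := by
    intro x hx; by_contra h; exact hx (Or.inl h)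
  have hr := restrict_cnt (μ := μ) (ν := ν) h1 c1 R h2 (Pd F1 F2 D) hp1 hp2 hoff
  have hfib : (Finset.filter (fun F3 => Df F3 = D) (Finset.univ.filter fun F3 : Perm V =>
      Good μ ν F1 F2 F3 ∧ (R → Resp c F3))).card =
      Nat.card {F3 : Perm V // (Good μ ν F1 F2 F3 ∧ (R → Resp c F3)) ∧
      (∀ x, ¬ Pd F1 F2 D x → F3 x = F1 x) ∧
      (∀ x, Pd F1 F2 D x → F1 x = F2 x → F3 x ≠ F1 x)} := by
    rw [Nat.card_eq_fintype_card, Fintype.card_subtype, Finset.filter_filter]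
    congr 1
    apply Finset.filter_congr
    intro F3 _
    apply and_congr_right
    rintro ⟨g, -⟩
    have sw : ∀ x, F3 (F1 x) = x ↔ F3 x = F1 x := by
      intro x
      constructor
      · intro h; rw [← PM_app g.pm (F1 x), h]
      · intro h; rw [← h, PM_app g.pm]
    have mem : ∀ x, x ∈ Df F3 ↔ (F1 x = F2 x ∧ c x = true) ∧ F3 x ≠ F1 x := by
      intro x; simp [Df]
    constructor
    · rintro rfl
      constructor
      · intro x hx
        simp only [Pd, not_or, not_not] at hx
        obtain ⟨hx1, hx2, hx3⟩ := hx
        rw [mem] at hx2 hx3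
        by_cases hc : c x = true
        · by_contra hne; exact hx2 ⟨⟨hx1, hc⟩, hne⟩
        · by_contra hne
          refine hx3 ⟨⟨com hx1, ?_⟩, ?_⟩
          · rw [c1]; simpa using hc
          · rw [PM_app h1, ne_eq, sw]; exact hne
      · intro x hx he
        rcases hx with hx | hx | hx
        · exact absurd he hx
        · exact ((mem _).1 hx).2
        · have := ((mem _).1 hx).2
          rwa [PM_app h1, ne_eq, sw] at this
    · rintro ⟨a, b⟩
      ext x
      rw [mem]
      constructor
      · rintro ⟨⟨hx1, hx2⟩, hx3⟩
        have hp : Pd F1 F2 D x := by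
          by_contra hp; exact hx3 (a x hp)
        rcases hp with hx | hx | hx
        · exact absurd hx1 hx
        · exact hx
        · have := (hD' _ hx).2
          rw [c1, hx2] at this; simp at this
      · intro hx
        exact ⟨hD' x hx, b x (Or.inr (Or.inl hx)) (hD' x hx).1⟩
  rw [hfib, hr]
  have q1 : IsPerfectMatching (F1.subtypePerm hp1) :=
    ⟨by ext x; simp [PM_app h1], fun x hx => h1.2 x.1 (congrArg Subtype.val hx)⟩
  have q2 : IsPerfectMatching (F2.subtypePerm hp2) :=
    ⟨by ext x; simp [PM_app h2], fun x hx => h2.2 x.1 (congrArg Subtype.val hx)⟩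
  have qt : (F1.subtypePerm hp1 * F2.subtypePerm hp2).cycleType = π + π := by
    rw [← ht, ← cycleType_ofSubtype]
    congr 1
    refine ofSubtype_subtypePerm (p := Pd F1 F2 D) (f := F1 * F2)
      (fun x => (hp1 _).trans (hp2 x)) ?_
    intro x hx
    left
    intro h
    apply hx
    rw [mul_apply, ← h, PM_app h1]
  have qc := card_Pd h1 c1 hD h2
  rw [ht, Multiset.sum_add] at qc
  obtain ⟨e, me⟩ := model2 (c := fun x : {x // Pd F1 F2 D x} => c x.1) q1 q2
    (fun x => c1 x.1) (fun x => c2 x.1) (σ D.card) (by rw [qt, hσ])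
    (by rw [qc, Fintype.card_fin]; ring)
  exact me.cnt_eq R

lemma top_count {μ ν π : Multiset ℕ} (hμ : μ.card ≤ μ.sum) (hν : ν.card ≤ ν.sum)
    (hπ : π.card ≤ π.sum)
    (hle : π.sum - π.card ≤ (μ.sum - μ.card) + (ν.sum - ν.card)) {k : ℕ}
    (hk : k = (μ.sum - μ.card) + (ν.sum - ν.card) - (π.sum - π.card))
    (σ : Perm (Fin (π.sum + k))) (hσ : σ.cycleType = π) :
    (cnt μ ν (Js 1) (Js σ) Sum.isLeft False : ℝ) =
      Real.sqrt 2 ^ k * cnt μ ν (Js 1) (Js σ) Sum.isLeft True := by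
  classical
  set F1 := Js (1 : Perm (Fin (π.sum + k))) with hF1
  set F2 := Js σ with hF2
  have h1 : IsPerfectMatching F1 := Js_pm _
  have h2 : IsPerfectMatching F2 := Js_pm _
  have ht : (F1 * F2).cycleType = π + π := by
    rw [hF1, hF2, ct_Js]; simp [hσ]
  have hc : Fintype.card (Fin (π.sum + k) ⊕ Fin (π.sum + k)) = 2 * (π.sum + k) := by
    rw [Fintype.card_sum, Fintype.card_fin]; ring
  let C : Finset (Fin (π.sum + k) ⊕ Fin (π.sum + k) → Bool) :=
    Finset.univ.filter fun c => Resp c F1 ∧ Resp c F2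
  let M : Finset (Perm (Fin (π.sum + k) ⊕ Fin (π.sum + k))) :=
    Finset.univ.filter fun F3 => Good μ ν F1 F2 F3 ∧ Ex F1 F2 F3
  have dc := Finset.sum_card_bipartiteAbove_eq_sum_card_bipartiteBelow
    (s := C) (t := M) (fun c F3 => Resp c F3)
  have hB : cnt μ ν F1 F2 Sum.isLeft False = M.card := by
    rw [cnt, Nat.card_eq_fintype_card, Fintype.card_subtype]
    congr 1
    apply Finset.filter_congr
    intro x _
    simp
  have hA : ∀ c ∈ C, (Finset.bipartiteAbove (fun c F3 => Resp c F3) M c).card =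
      cnt μ ν F1 F2 Sum.isLeft True := by
    intro c hcC
    have hcC' : Resp c F1 ∧ Resp c F2 := by simpa [C] using hcC
    obtain ⟨e, me⟩ := model2 h1 h2 hcC'.1 hcC'.2 σ (by rw [ht, hσ]) (by rw [hc, Fintype.card_fin])
    rw [← me.cnt_eq True, cnt, Nat.card_eq_fintype_card, Fintype.card_subtype]
    congr 1
    ext x
    simp only [Finset.mem_bipartiteAbove, M, Finset.mem_filter, Finset.mem_univ, true_and]
    tauto
  have hCc : C.card = 2 ^ Nat.card (Q2 F1 F2) := by
    rw [← card_col2 (c0 := Sum.isLeft) (Js_col 1) (Js_col σ), Nat.card_eq_fintype_card,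
      Fintype.card_subtype]
  have hM : ∀ F3 ∈ M, 2 * Nat.card (Q3 F1 F2 F3) + k = 2 * Nat.card (Q2 F1 F2) ∧
      (Finset.bipartiteBelow (fun c F3 => Resp c F3) C F3).card = 2 ^ Nat.card (Q3 F1 F2 F3) := by
    intro F3 hF3
    have hF3' : Good μ ν F1 F2 F3 ∧ Ex F1 F2 F3 := by simpa [M] using hF3
    obtain ⟨a, c, b1, b2, b3⟩ := (deg_main hμ hν hπ hle h1 h2 ht hc hF3'.1 hF3'.2).2 hk
    refine ⟨a, ?_⟩
    rw [← card_col3 b1 b2 b3, Nat.card_eq_fintype_card, Fintype.card_subtype]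
    congr 1
    ext x
    simp only [Finset.mem_bipartiteBelow, C, Finset.mem_filter, Finset.mem_univ, true_and]
    tauto
  rw [Finset.sum_congr rfl hA, Finset.sum_const, hCc, smul_eq_mul] at dc
  rw [hB]
  rcases M.eq_empty_or_nonempty with h0 | ⟨F0, h0⟩
  · rw [h0] at dc
    simp only [Finset.sum_empty, mul_eq_zero, pow_eq_zero_iff', OfNat.ofNat_ne_zero, false_and,
      false_or] at dc
    rw [dc, h0]; simp
  · have hF0 := (hM F0 h0).1
    have : ∀ F3 ∈ M, (Finset.bipartiteBelow (fun c F3 => Resp c F3) C F3).card =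
        2 ^ Nat.card (Q3 F1 F2 F0) := by
      intro F3 h3
      have := hM F3 h3
      rw [this.2]
      congr 1
      omega
    rw [Finset.sum_congr rfl this, Finset.sum_const, smul_eq_mul] at dc
    obtain ⟨j, hj⟩ : ∃ j, k = 2 * j := ⟨Nat.card (Q2 F1 F2) - Nat.card (Q3 F1 F2 F0), by omega⟩
    have hQ : Nat.card (Q2 F1 F2) = Nat.card (Q3 F1 F2 F0) + j := by omega
    rw [hQ, pow_add] at dc
    have h3 : M.card = 2 ^ j * cnt μ ν F1 F2 Sum.isLeft True := by
      have hpos : 0 < 2 ^ Nat.card (Q3 F1 F2 F0) := by positivity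
      apply Nat.eq_of_mul_eq_mul_left hpos
      rw [← mul_assoc, dc, mul_comm]
    have hs : Real.sqrt 2 ^ k = 2 ^ j := by
      rw [hj, pow_mul, Real.sq_sqrt (by norm_num)]
    rw [h3, hs]
    push_cast
    ring

end
end HFH

namespace HFH
set_option linter.unusedSectionVars false
open Equiv Equiv.Perm

lemma poly {K : Type*} [Field K] [CharZero K] (b : ℕ → K) (d s : ℕ)
    (hb : ∀ k, d < k → b k = 0) :
    ∃ p : Polynomial K, p.natDegree ≤ d ∧ p.coeff d = b d / (d.factorial : K) ∧
      ∀ m : ℕ, p.eval ((s + m : ℕ) : K) =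
        ∑ k ∈ Finset.range (m + 1), (m.choose k : K) * b k := by
  let q : ℕ → Polynomial K := fun k =>
    (descPochhammer K k).comp (Polynomial.X - Polynomial.C (s : K))
  have hmon : ∀ k, (q k).Monic := fun k =>
    (monic_descPochhammer K k).comp (Polynomial.monic_X_sub_C _)
      (by rw [Polynomial.natDegree_X_sub_C]; exact one_ne_zero)
  have hdeg : ∀ k, (q k).natDegree = k := by
    intro k
    simp only [q]
    rw [Polynomial.natDegree_comp, Polynomial.natDegree_X_sub_C, descPochhammer_natDegree, mul_one]
  refine ⟨∑ k ∈ Finset.range (d + 1), Polynomial.C (b k / (k.factorial : K)) * q k, ?_, ?_, ?_⟩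
  · apply Polynomial.natDegree_sum_le_of_forall_le
    intro k hk
    refine (Polynomial.natDegree_C_mul_le _ _).trans ?_
    rw [hdeg]
    have := Finset.mem_range.1 hk
    omega
  · rw [Polynomial.finsetSum_coeff, Finset.sum_range_succ, Finset.sum_eq_zero, zero_add,
      Polynomial.coeff_C_mul]
    · have := hmon d
      rw [Polynomial.Monic, Polynomial.leadingCoeff, hdeg] at this
      rw [this, mul_one]
    · intro k hk
      rw [Polynomial.coeff_C_mul, Polynomial.coeff_eq_zero_of_natDegree_lt, mul_zero]
      rw [hdeg]; exact Finset.mem_range.1 hk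
  · intro m
    have ev : ∀ k, (Polynomial.C (b k / (k.factorial : K)) * q k).eval ((s + m : ℕ) : K) =
        (m.choose k : K) * b k := by
      intro k
      have hk : (k.factorial : K) ≠ 0 := by exact_mod_cast k.factorial_ne_zero
      simp only [q, Polynomial.eval_mul, Polynomial.eval_C, Polynomial.eval_comp,
        Polynomial.eval_sub, Polynomial.eval_X]
      rw [show ((s + m : ℕ) : K) - s = (m : K) by push_cast; ring,
        descPochhammer_eval_eq_descFactorial, Nat.descFactorial_eq_factorial_mul_choose]
      push_cast
      field_simp
    rw [Polynomial.eval_finsetSum, Finset.sum_congr rfl (fun k _ => ev k)]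
    have e1 : ∑ k ∈ Finset.range (d + 1), (m.choose k : K) * b k =
        ∑ k ∈ Finset.range (max d m + 1), (m.choose k : K) * b k := by
      apply Finset.sum_subset
      · intro k hk
        simp only [Finset.mem_range] at hk ⊢
        omega
      · intro k _ hk
        rw [hb k (by simp only [Finset.mem_range] at hk; omega), mul_zero]
    have e2 : ∑ k ∈ Finset.range (m + 1), (m.choose k : K) * b k =
        ∑ k ∈ Finset.range (max d m + 1), (m.choose k : K) * b k := by
      apply Finset.sum_subset
      · intro k hk
        simp only [Finset.mem_range] at hk ⊢
        omega
      · intro k _ hk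
        rw [Nat.choose_eq_zero_of_lt (by simp only [Finset.mem_range] at hk; omega)]
        simp
    rw [e1, e2]

lemma Js_inj {A : Type*} {σ τ : Perm A} (h : Js σ = Js τ) : σ = τ := by
  ext a
  have := congrArg (fun F => F (Sum.inl a)) h
  simp only [Js_inl] at this
  exact Sum.inr_injective this

lemma Js_surj {A : Type*} [Finite A] {F : Perm (A ⊕ A)} (h : IsPerfectMatching F)
    (c : Resp Sum.isLeft F) : ∃ τ, Js τ = F := by
  have h1 : ∀ a, ∃ b, F (Sum.inl a) = Sum.inr b := by
    intro a
    have := c (Sum.inl a)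
    rcases hF : F (Sum.inl a) with x | x
    · rw [hF] at this; simp at this
    · exact ⟨x, rfl⟩
  choose f hf using h1
  have finj : Function.Injective f := by
    intro a b hab
    have : F (Sum.inl a) = F (Sum.inl b) := by rw [hf, hf, hab]
    exact Sum.inl_injective (F.injective this)
  refine ⟨Equiv.ofBijective f (Finite.injective_iff_bijective.1 finj), ?_⟩
  set τ := Equiv.ofBijective f (Finite.injective_iff_bijective.1 finj) with hτ
  have hτf : ∀ a, τ a = f a := fun a => rfl
  ext x
  rcases x with a | b
  · rw [Js_inl, hf, hτf]
  · rw [Js_inr]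
    obtain ⟨a, rfl⟩ := τ.surjective b
    rw [symm_apply_apply, hτf, ← hf, PM_app h]

lemma bip {A : Type*} [Fintype A] [DecidableEq A] (μ ν : Multiset ℕ) (σ : Perm A) :
    Nat.card {p : Perm A × Perm A // p.1.cycleType = μ ∧ p.2.cycleType = ν ∧ p.1 * p.2 = σ} =
    Nat.card {F3 : Perm (A ⊕ A) // Good μ ν (Js 1) (Js σ) F3 ∧ (True → Resp Sum.isLeft F3)} := by
  have key : ∀ a b : Perm A, a * b = σ → σ⁻¹ * a = b⁻¹ := by
    rintro a b rfl; simp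
  apply Nat.card_eq_of_bijective (fun p => ⟨Js p.1.1, ⟨Js_pm _, by
    rw [ct_Js, inv_one, one_mul, p.2.1], by
    rw [ct_Js, key _ _ p.2.2.2, cycleType_inv, p.2.2.1]⟩, fun _ => Js_col _⟩)
  constructor
  · rintro ⟨⟨a, b⟩, ha⟩ ⟨⟨a', b'⟩, ha'⟩ h
    have h' : a = a' := Js_inj (congrArg Subtype.val h)
    subst h'
    have : b = b' := mul_left_cancel (ha.2.2.trans ha'.2.2.symm)
    subst this
    rfl
  · rintro ⟨F3, g, r⟩
    obtain ⟨τ, rfl⟩ := Js_surj g.pm (r trivial)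
    have t1 := g.t1
    have t2 := g.t2
    rw [ct_Js] at t1 t2
    have t1' := add_self_inj t1
    have t2' := add_self_inj t2
    refine ⟨⟨(τ, τ⁻¹ * σ), by simpa using t1', ?_, by simp⟩, rfl⟩
    rw [← t2', ← cycleType_inv]; simp

lemma card_le_sum {μ : Multiset ℕ} (h : ∀ x ∈ μ, 2 ≤ x) : μ.card ≤ μ.sum := by
  have := Multiset.card_nsmul_le_sum (a := 1) (s := μ) (fun x hx => by have := h x hx; omega)
  simpa using this

lemma main
    (μ ν π : Multiset ℕ)
    (hμ : ∀ x ∈ μ, 2 ≤ x) (hν : ∀ x ∈ ν, 2 ≤ x) (hπ : ∀ x ∈ π, 2 ≤ x)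
    (hle : π.sum - π.card ≤ (μ.sum - μ.card) + (ν.sum - ν.card)) (d : ℕ)
    (hd : d = (μ.sum - μ.card) + (ν.sum - ν.card) - (π.sum - π.card)) :
    ∃ (P : Polynomial ℝ) (Q : Polynomial ℚ),
      P.natDegree ≤ d ∧
      Q.natDegree ≤ d ∧
      ((Q.coeff d : ℝ) = P.coeff d) ∧
      (∀ (n : ℕ) (σ : Equiv.Perm (Fin n)), σ.cycleType = π →
        (Nat.card {p : Equiv.Perm (Fin n) × Equiv.Perm (Fin n) //
            p.1.cycleType = μ ∧ p.2.cycleType = ν ∧ p.1 * p.2 = σ} : ℚ)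
          = Q.eval (n : ℚ)) ∧
      (∀ (n : ℕ) (F₁ F₂ : Equiv.Perm (Fin (2 * n))),
        IsPerfectMatching F₁ → IsPerfectMatching F₂ →
        (F₁ * F₂).cycleType = π + π →
        (Nat.card {F₃ : Equiv.Perm (Fin (2 * n)) //
            IsPerfectMatching F₃ ∧ (F₁ * F₃).cycleType = μ + μ ∧
            (F₂ * F₃).cycleType = ν + ν} : ℝ)
          = Real.sqrt 2 ^ d * P.eval (n : ℝ)) := by
  have hσ : ∀ k, ∃ σ : Perm (Fin (π.sum + k)), σ.cycleType = π := by
    intro k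
    rw [exists_with_cycleType_iff, Fintype.card_fin]
    exact ⟨by omega, hπ⟩
  choose σ hσ using hσ
  have cμ := card_le_sum hμ
  have cν := card_le_sum hν
  have cπ := card_le_sum hπ
  have hz : ∀ R k, d < k → cnt μ ν (Js 1) (Js (σ k)) Sum.isLeft R = 0 := by
    intro R k hk
    rw [cnt, Nat.card_eq_zero]
    left
    constructor
    rintro ⟨F3, g, -, ex⟩
    have := (deg_main (k := k) cμ cν cπ hle (Js_pm 1) (Js_pm (σ k)) (by rw [ct_Js]; simp [hσ])
      (by rw [Fintype.card_sum, Fintype.card_fin]; ring) g ex).1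
    omega
  have h2 : Real.sqrt 2 ^ d ≠ 0 := by positivity
  obtain ⟨P, P1, P2, P3⟩ := poly
    (fun k => (cnt μ ν (Js 1) (Js (σ k)) Sum.isLeft False : ℝ) / Real.sqrt 2 ^ d) d π.sum
    (fun k hk => by simp only [hz False k hk]; simp)
  obtain ⟨Q, Q1, Q2, Q3⟩ := poly
    (fun k => (cnt μ ν (Js 1) (Js (σ k)) Sum.isLeft True : ℚ)) d π.sum
    (fun k hk => by simp only [hz True k hk]; simp)
  refine ⟨P, Q, P1, Q1, ?_, ?_, ?_⟩
  · rw [P2, Q2, top_count cμ cν cπ hle hd (σ d) (hσ d)]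
    push_cast
    field_simp
  · intro n τ hτ
    have t1 : ((Js 1) * (Js τ)).cycleType = π + π := by rw [ct_Js]; simp [hτ]
    have c := card_Tp (Js_pm 1) (Js_col 1) (Js_pm τ)
    rw [t1, Multiset.sum_add, Fintype.card_sum, Fintype.card_fin] at c
    have hn : n = π.sum + (Tp (Js 1) (Js τ) Sum.isLeft).card := by omega
    rw [bip, total True (Js_pm 1) (Js_pm τ) (Js_col 1) (Js_col τ) t1 σ hσ]
    conv_rhs => rw [hn]
    rw [Q3]
    push_cast
    rfl
  · intro n F1 F2 h1 h2' t1
    obtain ⟨c, c1, c2⟩ := exists_col h1 h2'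
    have cc := card_Tp h1 c1 h2'
    rw [t1, Multiset.sum_add, Fintype.card_fin] at cc
    have hn : n = π.sum + (Tp F1 F2 c).card := by omega
    have e : Nat.card {F₃ : Equiv.Perm (Fin (2 * n)) //
            IsPerfectMatching F₃ ∧ (F1 * F₃).cycleType = μ + μ ∧
            (F2 * F₃).cycleType = ν + ν} =
        Nat.card {F3 : Perm (Fin (2 * n)) // Good μ ν F1 F2 F3 ∧ (False → Resp c F3)} := by
      apply Nat.card_congr
      apply Equiv.subtypeEquivRight
      intro F3
      constructor
      · rintro ⟨a, b, e⟩; exact ⟨⟨a, b, e⟩, False.elim⟩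
      · rintro ⟨⟨a, b, e⟩, -⟩; exact ⟨a, b, e⟩
    have ev : P.eval (n : ℝ) = P.eval ((π.sum + (Tp F1 F2 c).card : ℕ) : ℝ) := by
      rw [← hn]
    rw [e, total False h1 h2' c1 c2 t1 σ hσ, ev, P3, Finset.mul_sum]
    push_cast
    apply Finset.sum_congr rfl
    intro k _
    field_simp

end HFH

/-- The paper's analogue of Farahat–Higman's theorem for the Hecke algebra of the
pair (S_{2n}, H_n), expressed via perfect matchings: the structure constants of the
center of the symmetric group algebra and (suitably renormalized) of the Hecke
algebra are polynomials in `n` of degree at most `d`, with the same top coefficient. -/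
theorem hecke_farahat_higman
    (μ ν π : Multiset ℕ)
    (hμ : ∀ x ∈ μ, 2 ≤ x) (hν : ∀ x ∈ ν, 2 ≤ x) (hπ : ∀ x ∈ π, 2 ≤ x)
    (hle : π.sum - π.card ≤ (μ.sum - μ.card) + (ν.sum - ν.card)) :
    ∃ (P : Polynomial ℝ) (Q : Polynomial ℚ),
      P.natDegree ≤ (μ.sum - μ.card) + (ν.sum - ν.card) - (π.sum - π.card) ∧
      Q.natDegree ≤ (μ.sum - μ.card) + (ν.sum - ν.card) - (π.sum - π.card) ∧
      ((Q.coeff ((μ.sum - μ.card) + (ν.sum - ν.card) - (π.sum - π.card)) : ℝ)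
        = P.coeff ((μ.sum - μ.card) + (ν.sum - ν.card) - (π.sum - π.card))) ∧
      (∀ (n : ℕ) (σ : Equiv.Perm (Fin n)), σ.cycleType = π →
        (Nat.card {p : Equiv.Perm (Fin n) × Equiv.Perm (Fin n) //
            p.1.cycleType = μ ∧ p.2.cycleType = ν ∧ p.1 * p.2 = σ} : ℚ)
          = Q.eval (n : ℚ)) ∧
      (∀ (n : ℕ) (F₁ F₂ : Equiv.Perm (Fin (2 * n))),
        IsPerfectMatching F₁ → IsPerfectMatching F₂ →
        (F₁ * F₂).cycleType = π + π →
        (Nat.card {F₃ : Equiv.Perm (Fin (2 * n)) //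
            IsPerfectMatching F₃ ∧ (F₁ * F₃).cycleType = μ + μ ∧
            (F₂ * F₃).cycleType = ν + ν} : ℝ)
          = Real.sqrt 2 ^ ((μ.sum - μ.card) + (ν.sum - ν.card) - (π.sum - π.card))
            * P.eval (n : ℝ)) := by
  exact HFH.main μ ν π hμ hν hπ hle _ rfl
end

section
/- Fix multisets μ, ν, π of natural numbers all of whose elements are at least 2, and assume (μ.sum − μ.card) + (ν.sum − ν.card) = π.sum − π.card. Then for all natural numbers n and m, for all fixed-point-free involutions F₁, F₂ of Fin (2n) with cycleType (F₁ * F₂) = π + π, and for every permutation σ of Fin m with cycleType σ = π, the number of fixed-point-free involutions F₃ of Fin (2n) with cycleType (F₁ * F₃) = μ + μ and cycleType (F₂ * F₃) = ν + ν equals the number of pairs (σ₁, σ₂) of permutations of Fin m with cycleType σ₁ = μ, cycleType σ₂ = ν and σ₁ * σ₂ = σ. In particular, both counts are independent of n and m respectively. -/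
open Equiv Equiv.Perm

section geo
variable {α : Type*} [Fintype α] [DecidableEq α]

/-- Functions invariant under a permutation. -/
def fixSub (σ : Perm α) : Submodule ℚ (α → ℚ) where
  carrier := {f | ∀ x, f (σ x) = f x}
  add_mem' := by intro a b ha hb x; simp [ha x, hb x]
  zero_mem' := by intro x; rfl
  smul_mem' := by intro c f hf x; simp [hf x]

theorem fixSub_sameCycle {σ : Perm α} {f : α → ℚ} (hf : f ∈ fixSub σ) {x y : α}
    (h : σ.SameCycle x y) : f x = f y := by
  obtain ⟨k, hk, rfl⟩ := h.exists_pow_eq'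
  clear hk h
  induction k with
  | zero => rfl
  | succ k ih => rw [pow_succ', Perm.mul_apply, hf, ih]

/-- Label of the orbit of a point. -/
noncomputable def orbLabel (σ : Perm α) (x : α) :
    σ.cycleFactorsFinset ⊕ (Function.fixedPoints σ) :=
  if h : σ x = x then Sum.inr ⟨x, h⟩
  else Sum.inl ⟨σ.cycleOf x, cycleOf_mem_cycleFactorsFinset_iff.2 (mem_support.2 h)⟩

theorem orbLabel_surj (σ : Perm α) : Function.Surjective (orbLabel σ) := by
  rintro (⟨c, hc⟩ | ⟨x, hx⟩)
  · obtain ⟨x, hx⟩ := (mem_cycleFactorsFinset_iff.1 hc).1.nonempty_support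
    refine ⟨x, ?_⟩
    have h1 : c = σ.cycleOf x := cycle_is_cycleOf hx hc
    have h2 : σ x ≠ x := mem_support.1 (mem_cycleFactorsFinset_support_le hc hx)
    simp [orbLabel, h2, h1]
  · have hx' : σ x = x := hx
    exact ⟨x, by simp [orbLabel, hx']⟩

theorem orbLabel_same {σ : Perm α} {x y : α} (h : orbLabel σ x = orbLabel σ y) :
    σ.SameCycle x y := by
  unfold orbLabel at h
  split_ifs at h with h1 h2 h2
  · have h' : x = y := congrArg Subtype.val (Sum.inr.inj h)
    rw [h']
  · simp at h
    exact (sameCycle_iff_cycleOf_eq_of_mem_support (mem_support.2 h1) (mem_support.2 h2)).2 h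

theorem orbLabel_apply (σ : Perm α) (x : α) : orbLabel σ (σ x) = orbLabel σ x := by
  by_cases h : σ x = x
  · rw [h]
  · have : σ.cycleOf (σ x) = σ.cycleOf x :=
      (SameCycle.cycleOf_eq (sameCycle_apply_left.2 (SameCycle.refl σ x)))
    simp [orbLabel, h, this]

theorem finrank_fixSub (σ : Perm α) :
    Module.finrank ℚ (fixSub σ) + σ.cycleType.sum = Fintype.card α + σ.cycleType.card := by
  have h1 : fixSub σ = LinearMap.range (LinearMap.funLeft ℚ ℚ (orbLabel σ)) := by
    ext f
    constructor
    · intro hf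
      refine ⟨fun q => f (Function.surjInv (orbLabel_surj σ) q), ?_⟩
      ext x
      simp only [LinearMap.funLeft_apply]
      exact fixSub_sameCycle hf (orbLabel_same (Function.surjInv_eq (orbLabel_surj σ) _))
    · rintro ⟨g, rfl⟩ x
      simp [LinearMap.funLeft_apply, orbLabel_apply]
  rw [h1, LinearMap.finrank_range_of_inj (LinearMap.funLeft_injective_of_surjective _ _ _ (orbLabel_surj σ)),
    Module.finrank_fintype_fun_eq_card, Fintype.card_sum, card_fixedPoints]
  have h2 : Fintype.card σ.cycleFactorsFinset = σ.cycleType.card := by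
    simp [cycleType_def]
  have := sum_cycleType_le σ
  omega

/-- Cayley length. -/
def plen (σ : Perm α) : ℕ := σ.cycleType.sum - σ.cycleType.card

theorem card_le_sum_ms (s : Multiset ℕ) (h : ∀ x ∈ s, 2 ≤ x) : s.card ≤ s.sum := by
  have := Multiset.card_nsmul_le_sum (s := s) (a := 1) (fun x hx => by have := h x hx; omega)
  simpa using this

theorem plen_add (σ : Perm α) : plen σ + Module.finrank ℚ (fixSub σ) = Fintype.card α := by
  have h := finrank_fixSub σ
  have h1 : σ.cycleType.card ≤ σ.cycleType.sum :=
    card_le_sum_ms _ (fun x hx => two_le_of_mem_cycleType hx)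
  unfold plen
  omega

theorem plen_mul_le (σ τ : Perm α) : plen (σ * τ) ≤ plen σ + plen τ := by
  have h1 : fixSub σ ⊓ fixSub τ ≤ fixSub (σ * τ) := by
    rintro f ⟨hf, hg⟩ x
    rw [Perm.mul_apply, hf, hg]
  have h2 := Submodule.finrank_mono h1
  have h3 := Submodule.finrank_sup_add_finrank_inf_eq (fixSub σ) (fixSub τ)
  have h4 := Submodule.finrank_le (fixSub σ ⊔ fixSub τ)
  rw [Module.finrank_fintype_fun_eq_card] at h4
  have a := plen_add σ
  have b := plen_add τ
  have c := plen_add (σ * τ)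
  omega

theorem plen_swap_lt (σ : Perm α) (x : α) (h : σ x ≠ x) : plen (swap x (σ x) * σ) < plen σ := by
  have h1 : fixSub σ < fixSub (swap x (σ x) * σ) := by
    rw [SetLike.lt_iff_le_and_exists]
    constructor
    · intro f hf y
      rw [Perm.mul_apply, swap_apply_def]
      split_ifs with h1 h2
      · rw [hf, ← h1, hf]
      · rw [← hf y, h2, hf x]
      · exact hf y
    · refine ⟨Pi.single x 1, ?_, ?_⟩
      · intro y
        by_cases hy : y = x
        · subst hy; simp
        · have : (swap x (σ x) * σ) y ≠ x := by
            intro h'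
            apply hy
            apply (swap x (σ x) * σ).injective
            rw [h']; simp
          simp [Pi.single_apply, hy, this] at *
          simp [this]
      · intro h'
        have := h' x
        simp [Pi.single_apply, h] at this
  have h2 := Submodule.finrank_lt_finrank_of_lt h1
  have a := plen_add σ
  have b := plen_add (swap x (σ x) * σ)
  omega

theorem plen_swap_ge (σ : Perm α) (x y : α) (h : ¬ σ.SameCycle x y) :
    plen σ ≤ plen (swap x y * σ) := by
  have h1 : fixSub (swap x y * σ) ≤ fixSub σ := by
    intro f hf
    have hxy : f x = f y := by
      classical
      let O : Finset α := Finset.univ.filter (fun z => σ.SameCycle x z)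
      have e1 : ∑ z ∈ O, f (swap x y (σ z)) = ∑ z ∈ O, f z :=
        Finset.sum_congr rfl (fun z _ => hf z)
      have e2 : ∑ z ∈ O, f (swap x y (σ z)) = ∑ z ∈ O, f (swap x y z) := by
        refine Finset.sum_equiv σ ?_ ?_
        · intro z; simp [O]
        · intro z _; rfl
      have hx : x ∈ O := by simp [O, SameCycle.refl]
      have e3 : ∑ z ∈ O.erase x, f (swap x y z) = ∑ z ∈ O.erase x, f z := by
        refine Finset.sum_congr rfl (fun z hz => ?_)
        rw [swap_apply_of_ne_of_ne]
        · exact (Finset.mem_erase.1 hz).1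
        · rintro rfl
          simp [O] at hz
          exact h hz.2
      rw [e2, ← Finset.add_sum_erase _ _ hx, ← Finset.add_sum_erase _ f hx, e3] at e1
      simp at e1
      exact e1.symm
    intro z
    rw [← hf z, Perm.mul_apply, swap_apply_def]
    split_ifs with h1 h2
    · rw [h1, hxy]
    · rw [h2, hxy]
    · rfl
  have h2 := Submodule.finrank_mono h1
  have a := plen_add σ
  have b := plen_add (swap x y * σ)
  omega

theorem geodesic_sameCycle (σ τ : Perm α) (h : plen σ + plen τ = plen (σ * τ)) (x : α) :
    (σ * τ).SameCycle x (σ x) := by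
  by_cases hx : σ x = x
  · rw [hx]
  by_contra hc
  have h1 := plen_swap_ge _ _ _ hc
  have h2 := plen_swap_lt σ x hx
  have h3 := plen_mul_le (swap x (σ x) * σ) τ
  rw [mul_assoc] at h3
  omega


theorem geodesic_fix {σ τ : Perm α} (h : plen σ + plen τ = plen (σ * τ)) {x : α}
    (hx : (σ * τ) x = x) : σ x = x ∧ τ x = x := by
  have h1 : x = σ x := (geodesic_sameCycle σ τ h x).eq_of_left hx
  refine ⟨h1.symm, ?_⟩
  apply σ.injective
  rw [← h1]
  exact hx

theorem card_ofSubtype (μ ν : Multiset ℕ) (p : α → Prop) [DecidablePred p] (ρ : Perm (Subtype p))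
    (heq : (μ.sum - μ.card) + (ν.sum - ν.card) = plen (ofSubtype ρ)) :
    Nat.card {q : Perm (Subtype p) × Perm (Subtype p) //
      q.1.cycleType = μ ∧ q.2.cycleType = ν ∧ q.1 * q.2 = ρ} =
    Nat.card {q : Perm α × Perm α //
      q.1.cycleType = μ ∧ q.2.cycleType = ν ∧ q.1 * q.2 = ofSubtype ρ} := by
  refine Nat.card_eq_of_bijective
    (fun q => ⟨(ofSubtype q.1.1, ofSubtype q.1.2), ?_, ?_, ?_⟩) ⟨?_, ?_⟩
  · rw [cycleType_ofSubtype]; exact q.2.1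
  · rw [cycleType_ofSubtype]; exact q.2.2.1
  · rw [← map_mul, q.2.2.2]
  · rintro ⟨⟨a, b⟩, h⟩ ⟨⟨c, d⟩, h'⟩ hh
    simp only [Subtype.mk.injEq, Prod.mk.injEq] at hh ⊢
    exact ⟨ofSubtype_injective hh.1, ofSubtype_injective hh.2⟩
  · rintro ⟨⟨a, b⟩, ha, hb, hab⟩
    simp only at ha hb hab
    have hg : plen a + plen b = plen (a * b) := by
      rw [hab, ← heq, ← ha, ← hb]; rfl
    have key : ∀ x, ¬ p x → a x = x ∧ b x = x := by
      intro x hx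
      apply geodesic_fix hg
      rw [hab, ofSubtype_apply_of_not_mem _ hx]
    have h1 : a ∈ (ofSubtype (p := p)).range := by
      rw [mem_range_ofSubtype_iff]
      intro x hx
      by_contra hpx
      exact mem_support.1 (Finset.mem_coe.1 hx) (key x hpx).1
    have h2 : b ∈ (ofSubtype (p := p)).range := by
      rw [mem_range_ofSubtype_iff]
      intro x hx
      by_contra hpx
      exact mem_support.1 (Finset.mem_coe.1 hx) (key x hpx).2
    obtain ⟨a', rfl⟩ := h1
    obtain ⟨b', rfl⟩ := h2
    refine ⟨⟨(a', b'), ?_, ?_, ?_⟩, rfl⟩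
    · rw [cycleType_ofSubtype] at ha; exact ha
    · rw [cycleType_ofSubtype] at hb; exact hb
    · rw [← map_mul] at hab; exact ofSubtype_injective hab

variable {β : Type*} [Fintype β] [DecidableEq β]

theorem cycleType_permCongr' (e : α ≃ β) (σ : Perm α) :
    (e.permCongrHom σ).cycleType = σ.cycleType := by
  have : e.permCongrHom σ =
      σ.extendDomain (p := fun _ : β => True) (e.trans (Equiv.subtypeUnivEquiv (fun _ => trivial)).symm) := by
    ext x
    rw [extendDomain_apply_subtype _ _ trivial]
    rfl
  rw [this, cycleType_extendDomain]

theorem card_congr_of_equiv (μ ν : Multiset ℕ) (e : α ≃ β) (σ : Perm α) (σ' : Perm β)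
    (h : σ.cycleType = σ'.cycleType) :
    Nat.card {q : Perm α × Perm α //
      q.1.cycleType = μ ∧ q.2.cycleType = ν ∧ q.1 * q.2 = σ} =
    Nat.card {q : Perm β × Perm β //
      q.1.cycleType = μ ∧ q.2.cycleType = ν ∧ q.1 * q.2 = σ'} := by
  have h1 : IsConj (e.permCongrHom σ) σ' := by
    apply isConj_of_cycleType_eq
    rw [cycleType_permCongr', h]
  obtain ⟨c, hc⟩ := isConj_iff.1 h1
  let Φ : Perm α ≃* Perm β := e.permCongrHom.trans (MulAut.conj c)
  have hΦ : ∀ x, (Φ x).cycleType = x.cycleType := by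
    intro x
    simp only [Φ, MulEquiv.trans_apply, MulAut.conj_apply, cycleType_conj, cycleType_permCongr']
  have hσ : Φ σ = σ' := hc
  refine Nat.card_congr (Equiv.subtypeEquiv (Equiv.prodCongr Φ.toEquiv Φ.toEquiv) ?_)
  rintro ⟨a, b⟩
  have h3 : Φ a * Φ b = σ' ↔ a * b = σ := by
    rw [← hσ, ← map_mul]; exact Φ.injective.eq_iff
  simp [hΦ, h3]

theorem card_indep (μ ν : Multiset ℕ) (σ : Perm α) (σ' : Perm β)
    (h : σ.cycleType = σ'.cycleType)
    (heq : (μ.sum - μ.card) + (ν.sum - ν.card) = plen σ) :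
    Nat.card {q : Perm α × Perm α //
      q.1.cycleType = μ ∧ q.2.cycleType = ν ∧ q.1 * q.2 = σ} =
    Nat.card {q : Perm β × Perm β //
      q.1.cycleType = μ ∧ q.2.cycleType = ν ∧ q.1 * q.2 = σ'} := by
  have q : ∀ x, σ (σ x) ≠ σ x ↔ σ x ≠ x := fun x => σ.injective.ne_iff
  have q' : ∀ x, σ' (σ' x) ≠ σ' x ↔ σ' x ≠ x := fun x => σ'.injective.ne_iff
  have hs : ofSubtype (σ.subtypePerm (p := fun x => σ x ≠ x) q) = σ :=
    ofSubtype_subtypePerm _ (fun x hx => hx)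
  have hs' : ofSubtype (σ'.subtypePerm (p := fun x => σ' x ≠ x) q') = σ' :=
    ofSubtype_subtypePerm _ (fun x hx => hx)
  have hp : plen σ' = plen σ := by unfold plen; rw [h]
  have e1 := card_ofSubtype μ ν (fun x => σ x ≠ x) (σ.subtypePerm q)
    (by rw [hs, heq])
  have e2 := card_ofSubtype μ ν (fun x => σ' x ≠ x) (σ'.subtypePerm q')
    (by rw [hs', heq, hp])
  rw [hs] at e1
  rw [hs'] at e2
  rw [← e1, ← e2]
  have hc : Fintype.card {x // σ x ≠ x} = Fintype.card {x // σ' x ≠ x} := by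
    rw [Fintype.card_subtype, Fintype.card_subtype]
    have := sum_cycleType σ
    rw [h, sum_cycleType] at this
    exact this.symm
  refine card_congr_of_equiv μ ν (Fintype.equivOfCardEq hc) _ _ ?_
  rw [← cycleType_ofSubtype, hs, ← cycleType_ofSubtype, hs', h]

theorem IsPerfectMatching.app {γ : Type*} {F : Perm γ} (h : IsPerfectMatching F) (x : γ) : F (F x) = x := by
  rw [← Perm.mul_apply, h.1]; rfl

theorem IsPerfectMatching.inv {γ : Type*} {F : Perm γ} (h : IsPerfectMatching F) : F⁻¹ = F :=
  inv_eq_of_mul_eq_one_left h.1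

theorem ms_half {s t : Multiset ℕ} (h : s + s = t + t) : s = t := by
  ext a
  have := congrArg (Multiset.count a) h
  simp only [Multiset.count_add] at this
  omega

theorem bip_cycleType {F G : Perm α} (hF : IsPerfectMatching F) (hG : IsPerfectMatching G)
    (B : α → Prop) [DecidablePred B] (h1 : ∀ x, B (F x) ↔ ¬ B x) (h2 : ∀ x, B (G x) ↔ ¬ B x)
    (h : ∀ x, B ((F * G) x) ↔ B x) :
    (F * G).cycleType = ((F * G).subtypePerm h).cycleType + ((F * G).subtypePerm h).cycleType := by
  set a : Perm α := ofSubtype ((F * G).subtypePerm h) with ha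
  have a1 : ∀ x, B x → a x = F (G x) := by
    intro x hx
    rw [ha, ofSubtype_apply_of_mem _ hx]; rfl
  have a2 : ∀ x, ¬ B x → a x = x := fun x hx => ofSubtype_apply_of_not_mem _ hx
  have a3 : ∀ x, ¬ B x → a⁻¹ x = x := by
    intro x hx
    rw [inv_eq_iff_eq, a2 x hx]
  have a4 : ∀ x, B x → a⁻¹ x = G (F x) := by
    intro x hx
    rw [inv_eq_iff_eq, a1 _ (by rw [h2, h1]; simpa using hx), hG.app, hF.app]
  have hd : Disjoint a (F * a⁻¹ * F⁻¹) := by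
    intro x
    by_cases hx : B x
    · right
      rw [hF.inv]
      simp only [Perm.mul_apply]
      rw [a3 _ (by rw [h1]; simpa using hx), hF.app]
    · left; exact a2 x hx
  have he : F * G = a * (F * a⁻¹ * F⁻¹) := by
    ext x
    rw [hF.inv]
    simp only [Perm.mul_apply]
    by_cases hx : B x
    · rw [a3 _ (by rw [h1]; simpa using hx), hF.app, a1 x hx]
    · have : B (F x) := (h1 x).2 hx
      rw [a4 _ this, hF.app, a2]
      rw [h1, h2]; simpa using hx
  rw [← cycleType_ofSubtype (g := (F * G).subtypePerm h), ← ha]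
  conv_lhs => rw [he]
  rw [hd.cycleType_mul, cycleType_conj, cycleType_inv]

theorem hecke_to_perm (μ ν π : Multiset ℕ)
    (hμ : ∀ x ∈ μ, 2 ≤ x) (hν : ∀ x ∈ ν, 2 ≤ x) (hπ : ∀ x ∈ π, 2 ≤ x)
    (heq : (μ.sum - μ.card) + (ν.sum - ν.card) = π.sum - π.card)
    (F₁ F₂ : Perm α) (hF₁ : IsPerfectMatching F₁) (hF₂ : IsPerfectMatching F₂)
    (h12 : (F₁ * F₂).cycleType = π + π)
    (B : α → Prop) [DecidablePred B] (hB : ∀ x y, (F₁ * F₂).SameCycle x y → (B x ↔ B y))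
    (h1 : ∀ x, B (F₁ x) ↔ ¬ B x) (h : ∀ x, B ((F₁ * F₂) x) ↔ B x) :
    Nat.card {F₃ : Perm α // IsPerfectMatching F₃ ∧ (F₁ * F₃).cycleType = μ + μ ∧
          (F₂ * F₃).cycleType = ν + ν} =
    Nat.card {q : Perm (Subtype B) × Perm (Subtype B) //
      q.1.cycleType = μ ∧ q.2.cycleType = ν ∧ q.1 * q.2 = (F₁ * F₂).subtypePerm h} := by
  have h2 : ∀ x, B (F₂ x) ↔ ¬ B x := by
    intro x
    have := h x
    rw [Perm.mul_apply, h1] at this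
    tauto
  have hflip : ∀ F₃ : Perm α, IsPerfectMatching F₃ → (F₃ * F₂).cycleType = (F₂ * F₃).cycleType := by
    intro F₃ h3
    rw [← cycleType_inv, mul_inv_rev, h3.inv, hF₂.inv]
  have hpl : ∀ F₃ : Perm α, F₃ * F₃ = 1 → (F₁ * F₃) * (F₃ * F₂) = F₁ * F₂ := by
    intro F₃ h3
    rw [mul_assoc, ← mul_assoc F₃, h3, one_mul]
  have hsw : ∀ F₃ : Perm α, IsPerfectMatching F₃ → (F₁ * F₃).cycleType = μ + μ →
      (F₂ * F₃).cycleType = ν + ν → ∀ x, B (F₃ x) ↔ ¬ B x := by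
    intro F₃ h3 hm hn x
    have hg : plen (F₁ * F₃) + plen (F₃ * F₂) = plen ((F₁ * F₃) * (F₃ * F₂)) := by
      rw [hpl F₃ h3.1]
      unfold plen
      rw [hflip F₃ h3, hm, hn, h12]
      simp only [Multiset.sum_add, Multiset.card_add]
      have := card_le_sum_ms _ hμ
      have := card_le_sum_ms _ hν
      have := card_le_sum_ms _ hπ
      omega
    have := geodesic_sameCycle _ _ hg x
    rw [hpl F₃ h3.1] at this
    have := hB _ _ this
    rw [Perm.mul_apply, h1] at this
    tauto
  have hinv : ∀ F G : Perm α, (∀ x, B (F x) ↔ ¬ B x) → (∀ x, B (G x) ↔ ¬ B x) →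
      ∀ x, B ((F * G) x) ↔ B x := by
    intro F G hF hG x
    rw [Perm.mul_apply, hF, hG, not_not]
  refine Nat.card_eq_of_bijective (fun F => ⟨
    ((F₁ * F.1).subtypePerm (hinv _ _ h1 (hsw F.1 F.2.1 F.2.2.1 F.2.2.2)),
      (F.1 * F₂).subtypePerm (hinv _ _ (hsw F.1 F.2.1 F.2.2.1 F.2.2.2) h2)), ?_, ?_, ?_⟩) ⟨?_, ?_⟩
  · apply ms_half
    refine Eq.trans ?_ F.2.2.1
    exact (bip_cycleType hF₁ F.2.1 B h1 (hsw F.1 F.2.1 F.2.2.1 F.2.2.2)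
      (hinv _ _ h1 (hsw F.1 F.2.1 F.2.2.1 F.2.2.2))).symm
  · apply ms_half
    refine Eq.trans ?_ ((hflip F.1 F.2.1).trans F.2.2.2)
    exact (bip_cycleType F.2.1 hF₂ B (hsw F.1 F.2.1 F.2.2.1 F.2.2.2) h2
      (hinv _ _ (hsw F.1 F.2.1 F.2.2.1 F.2.2.2) h2)).symm
  · apply Perm.ext; intro x; apply Subtype.ext
    show F₁ (F.1 (F.1 (F₂ x))) = F₁ (F₂ x)
    rw [F.2.1.app]
  · rintro ⟨F, hF, hF'⟩ ⟨G, hG, hG'⟩ hh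
    simp only [Subtype.mk.injEq, Prod.mk.injEq] at hh ⊢
    have e1 : ∀ x, B x → F x = G x := by
      intro x hx
      have := congrArg Subtype.val (DFunLike.congr_fun hh.1 ⟨x, hx⟩)
      simpa using this
    ext x
    by_cases hx : B x
    · exact e1 x hx
    · have hx' : B (F x) := (hsw F hF hF'.1 hF'.2 x).2 hx
      have := e1 _ hx'
      rw [hF.app] at this
      apply G.injective
      rw [← this, hG.app]
  · rintro ⟨⟨a, b⟩, ha, hb, hab⟩
    simp only at ha hb hab
    set A : Perm α := ofSubtype a with hA
    have A2 : ∀ x, ¬ B x → A x = x := fun x hx => ofSubtype_apply_of_not_mem _ hx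
    have A3 : ∀ x, ¬ B x → A⁻¹ x = x := by
      intro x hx
      rw [inv_eq_iff_eq, A2 x hx]
    have AB : ∀ x, B (A x) ↔ B x := fun x => ofSubtype_apply_mem_iff_mem a x
    have AB' : ∀ x, B (A⁻¹ x) ↔ B x := fun x => by rw [← AB, show A (A⁻¹ x) = x from A.apply_symm_apply x]
    set F : Perm α := A⁻¹ * F₁ * A with hFdef
    have hF : IsPerfectMatching F := by
      constructor
      · rw [hFdef]
        calc A⁻¹ * F₁ * A * (A⁻¹ * F₁ * A) = A⁻¹ * (F₁ * F₁) * A := by group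
          _ = 1 := by rw [hF₁.1]; group
      · intro x hx
        rw [hFdef, Perm.mul_apply, Perm.mul_apply, inv_eq_iff_eq] at hx
        exact hF₁.2 _ hx
    have hFB : ∀ x, B (F x) ↔ ¬ B x := by
      intro x
      rw [hFdef, Perm.mul_apply, Perm.mul_apply, AB', h1, AB]
    have r1 : (F₁ * F).subtypePerm (hinv _ _ h1 hFB) = a := by
      ext ⟨x, hx⟩
      simp only [subtypePerm_apply, Perm.mul_apply, hFdef]
      rw [A3 _ (by rw [h1, AB]; simpa using hx), hF₁.app, hA, ofSubtype_apply_of_mem _ hx]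
    have r2 : (F * F₂).subtypePerm (hinv _ _ hFB h2) = b := by
      apply mul_left_cancel (a := a)
      rw [hab]
      conv_lhs => rw [← r1]
      apply Perm.ext; intro x; apply Subtype.ext
      show F₁ (F (F (F₂ x))) = F₁ (F₂ x)
      rw [hF.app]
    refine ⟨⟨F, hF, ?_, ?_⟩, ?_⟩
    · rw [bip_cycleType hF₁ hF B h1 hFB (hinv _ _ h1 hFB), r1, ha]
    · rw [← hflip F hF, bip_cycleType hF hF₂ B hFB h2 (hinv _ _ hFB h2), r2, hb]
    · simp only [r1, r2]

theorem exists_color [LinearOrder α] (F₁ F₂ : Perm α) (hF₁ : IsPerfectMatching F₁)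
    (hF₂ : IsPerfectMatching F₂) :
    ∃ B : α → Prop, (∀ x y, (F₁ * F₂).SameCycle x y → (B x ↔ B y)) ∧
      (∀ x, B (F₁ x) ↔ ¬ B x) := by
  set g := F₁ * F₂ with hg
  have hconj : ∀ k : ℤ, F₁ * g ^ k = g ^ (-k) * F₁ := by
    intro k
    have h1 : F₁ * g * F₁⁻¹ = g⁻¹ := by
      rw [hg, mul_inv_rev, hF₁.inv, hF₂.inv, ← mul_assoc, hF₁.1, one_mul]
    have h2 : F₁ * g ^ k * F₁⁻¹ = g ^ (-k) := by
      rw [← conj_zpow, h1, inv_zpow, zpow_neg]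
    rw [← h2]; group
  have hgF : ∀ x y, g.SameCycle x y → g.SameCycle (F₁ x) (F₁ y) := by
    rintro x y ⟨k, rfl⟩
    refine ⟨-k, ?_⟩
    rw [← Perm.mul_apply, ← hconj, Perm.mul_apply]
  have hne : ∀ x, ¬ g.SameCycle x (F₁ x) := by
    rintro x ⟨k, hk⟩
    obtain ⟨j, rfl | rfl⟩ := Int.even_or_odd' k
    · apply hF₁.2 ((g ^ j) x)
      rw [← Perm.mul_apply, hconj, Perm.mul_apply, ← hk, ← Perm.mul_apply, ← zpow_add]
      congr 2; ring
    · apply hF₂.2 ((g ^ j) x)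
      apply F₁.injective
      rw [← Perm.mul_apply F₁ (g ^ j), hconj, Perm.mul_apply, ← hk, ← Perm.mul_apply F₁, ← hg,
        ← Perm.mul_apply, ← Perm.mul_apply, ← zpow_add, ← zpow_one_add]
      congr 2; ring
  let lab : α → α := fun x => (Quotient.mk (SameCycle.setoid g) x).out
  have lab1 : ∀ x y, g.SameCycle x y → lab x = lab y := by
    intro x y h
    have : Quotient.mk (SameCycle.setoid g) x = Quotient.mk (SameCycle.setoid g) y :=
      Quotient.sound h
    simp only [lab, this]
  have lab2 : ∀ x y, lab x = lab y → g.SameCycle x y := by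
    intro x y h
    exact Quotient.exact (s := SameCycle.setoid g) (Quotient.out_inj.1 h)
  refine ⟨fun x => lab x < lab (F₁ x), ?_, ?_⟩
  · intro x y h
    show lab x < lab (F₁ x) ↔ lab y < lab (F₁ y)
    rw [lab1 _ _ h, lab1 _ _ (hgF _ _ h)]
  · intro x
    simp only [hF₁.app]
    have : lab x ≠ lab (F₁ x) := fun h => hne x (lab2 _ _ h)
    rw [not_lt, le_iff_lt_or_eq]
    have := this.symm
    tauto

end geo

/-- In the top-degree case `(|μ|-ℓ(μ)) + (|ν|-ℓ(ν)) = |π|-ℓ(π)`, the (renormalized)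
Hecke-algebra structure constant equals the symmetric-group structure constant;
in particular both counts are independent of `n` and `m`. -/
theorem hecke_equals_symmetric_top_degree
    (μ ν π : Multiset ℕ)
    (hμ : ∀ x ∈ μ, 2 ≤ x) (hν : ∀ x ∈ ν, 2 ≤ x) (hπ : ∀ x ∈ π, 2 ≤ x)
    (heq : (μ.sum - μ.card) + (ν.sum - ν.card) = π.sum - π.card) :
    ∀ (n m : ℕ) (F₁ F₂ : Equiv.Perm (Fin (2 * n))) (σ : Equiv.Perm (Fin m)),
      IsPerfectMatching F₁ → IsPerfectMatching F₂ →
      (F₁ * F₂).cycleType = π + π → σ.cycleType = π →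
      Nat.card {F₃ : Equiv.Perm (Fin (2 * n)) //
          IsPerfectMatching F₃ ∧ (F₁ * F₃).cycleType = μ + μ ∧
          (F₂ * F₃).cycleType = ν + ν}
        = Nat.card {p : Equiv.Perm (Fin m) × Equiv.Perm (Fin m) //
            p.1.cycleType = μ ∧ p.2.cycleType = ν ∧ p.1 * p.2 = σ} := by
  intro n m F₁ F₂ σ hF₁ hF₂ h12 hσ
  obtain ⟨B, hB, h1⟩ := exists_color F₁ F₂ hF₁ hF₂
  classical
  have h : ∀ x, B ((F₁ * F₂) x) ↔ B x := fun x =>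
    hB _ _ (sameCycle_apply_left.2 (SameCycle.refl _ x))
  have h2 : ∀ x, B (F₂ x) ↔ ¬ B x := by
    intro x
    have := h x
    rw [Perm.mul_apply, h1] at this
    tauto
  rw [hecke_to_perm μ ν π hμ hν hπ heq F₁ F₂ hF₁ hF₂ h12 B hB h1 h]
  have hc : ((F₁ * F₂).subtypePerm h).cycleType = π := by
    apply ms_half
    rw [← h12]
    exact (bip_cycleType hF₁ hF₂ B h1 h2 h).symm
  refine card_indep μ ν _ σ (hc.trans hσ.symm) ?_
  unfold plen
  rw [hc, heq]
end

section
/- Let k ≥ 2 and n be natural numbers, and let F₁ be any fixed-point-free involution of Fin (2(k + n)). The number of fixed-point-free involutions F₃ of Fin (2(k + n)) such that Equiv.Perm.cycleType (F₁ * F₃) = {k, k} equals (k + n).choose k * 2^(k − 1) * (k − 1)!. -/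
theorem pm_FF {α : Type*} {F : Equiv.Perm α} (hF : IsPerfectMatching F) (x : α) :
    F (F x) = x := by
  rw [← Equiv.Perm.mul_apply, hF.1]; rfl

theorem pm_zpow_ne {α : Type*} {F G : Equiv.Perm α} (hF : IsPerfectMatching F)
    (hG : IsPerfectMatching G) (i : ℤ) (x : α) : ((F * G) ^ i) x ≠ F x := by
  intro h
  have hFi : F⁻¹ = F := inv_eq_of_mul_eq_one_left hF.1
  have hGi : G⁻¹ = G := inv_eq_of_mul_eq_one_left hG.1
  have hconj : ∀ j : ℤ, F * (F * G) ^ j = (F * G) ^ (-j) * F := by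
    intro j
    have h1 : F * (F * G) * F⁻¹ = (F * G)⁻¹ := by
      rw [mul_inv_rev, hFi, hGi, ← mul_assoc, hF.1, one_mul]
    have h2 : F * (F * G) ^ j * F⁻¹ = (F * G) ^ (-j) := by
      rw [← conj_zpow, h1, inv_zpow, zpow_neg]
    rw [← h2]; group
  have hc : ∀ (j : ℤ) (y : α), F (((F * G) ^ j) y) = ((F * G) ^ (-j)) (F y) := by
    intro j y
    have := congrArg (fun p : Equiv.Perm α => p y) (hconj j)
    simpa only [Equiv.Perm.mul_apply] using this
  rcases Int.even_or_odd' i with ⟨j, rfl | rfl⟩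
  · apply hF.2 (((F * G) ^ j) x)
    rw [hc, ← h, ← Equiv.Perm.mul_apply, ← zpow_add]
    congr 2; ring
  · apply hG.2 (((F * G) ^ j) x)
    have : G = F * (F * G) := by rw [← mul_assoc, hF.1, one_mul]
    have h3 : G (((F * G) ^ j) x) = F (((F * G) ^ (j + 1)) x) := by
      rw [add_comm, zpow_add, zpow_one]
      simp only [Equiv.Perm.mul_apply]
      rw [pm_FF hF]
    rw [h3, hc, ← h, ← Equiv.Perm.mul_apply, ← zpow_add]
    congr 2; ring

/-- transversal subsets -/
def Transv {α : Type*} (F : Equiv.Perm α) (A : Finset α) : Prop := ∀ x ∈ A, F x ∉ A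

section cnt
open Finset Classical
variable {α : Type*} [Fintype α]

theorem card_transv_step {F : Equiv.Perm α} (hF : IsPerfectMatching F) (k : ℕ) :
    #{A : Finset α | Transv F A ∧ #A = k + 1} * (k + 1)
      = #{A : Finset α | Transv F A ∧ #A = k} * (Fintype.card α - 2 * k) := by
  apply card_mul_eq_card_mul (fun A B : Finset α => B ⊆ A)
  · intro A hA
    simp only [mem_filter, mem_univ, true_and] at hA
    have : (bipartiteAbove (fun A B : Finset α => B ⊆ A)
        ({A : Finset α | Transv F A ∧ #A = k} : Finset (Finset α)) A) = A.powersetCard k := by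
      ext B
      simp only [mem_bipartiteAbove, mem_filter, mem_univ, true_and, mem_powersetCard]
      constructor
      · tauto
      · rintro ⟨h1, h2⟩
        exact ⟨⟨fun x hx h => hA.1 x (h1 hx) (h1 h), h2⟩, h1⟩
    rw [this, card_powersetCard, hA.2]
    simp
  · intro B hB
    simp only [mem_filter, mem_univ, true_and] at hB
    have hd : Disjoint B (B.image F) := by
      rw [disjoint_left]
      intro x hx h
      obtain ⟨y, hy, rfl⟩ := mem_image.1 h
      exact hB.1 y hy hx
    have : (bipartiteBelow (fun A B : Finset α => B ⊆ A)
        ({A : Finset α | Transv F A ∧ #A = k + 1} : Finset (Finset α)) B)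
        = ((B ∪ B.image F)ᶜ).image (fun a => insert a B) := by
      ext A
      simp only [mem_bipartiteBelow, mem_filter, mem_univ, true_and, mem_image, mem_compl, mem_union]
      constructor
      · rintro ⟨⟨h1, h2⟩, h3⟩
        have h4 : #(A \ B) = 1 := by rw [card_sdiff_of_subset h3]; omega
        obtain ⟨a, ha⟩ := card_eq_one.1 h4
        have ha' : a ∈ A \ B := by rw [ha]; simp
        rw [mem_sdiff] at ha'
        refine ⟨a, ?_, ?_⟩
        · rintro (h | ⟨y, hy, rfl⟩)
          · exact ha'.2 h
          · exact h1 y (h3 hy) ha'.1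
        · rw [insert_eq, ← ha, sdiff_union_of_subset h3]
      · rintro ⟨a, ha, rfl⟩
        push Not at ha
        refine ⟨⟨?_, ?_⟩, subset_insert _ _⟩
        · intro x hx h
          rw [mem_insert] at hx h
          rcases hx with rfl | hx
          · rcases h with h | h
            · exact hF.2 _ h
            · exact ha.2 _ h (pm_FF hF x)
          · rcases h with h | h
            · exact ha.2 _ hx h
            · exact hB.1 x hx h
        · rw [card_insert_of_notMem ha.1, hB.2]
    rw [this, card_image_of_injOn, card_compl, card_union_of_disjoint hd,
      card_image_of_injective _ F.injective, hB.2, two_mul]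
    intro a ha b hb hab
    simp only [coe_compl, Set.mem_compl_iff, mem_coe, mem_union, not_or] at ha hb
    have : a ∈ insert b B := by
      have : a ∈ insert a B := mem_insert_self _ _
      simp only at hab
      rwa [hab] at this
    rcases mem_insert.1 this with h | h
    · exact h
    · exact absurd h ha.1

theorem card_transv {F : Equiv.Perm α} (hF : IsPerfectMatching F) (m : ℕ)
    (hm : Fintype.card α = 2 * m) (k : ℕ) :
    #{A : Finset α | Transv F A ∧ #A = k} = m.choose k * 2 ^ k := by
  induction k with
  | zero =>
    have : ({A : Finset α | Transv F A ∧ #A = 0} : Finset (Finset α)) = {∅} := by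
      ext A
      simp only [mem_filter, mem_univ, true_and, card_eq_zero, mem_singleton]
      constructor
      · tauto
      · rintro rfl
        exact ⟨fun x hx => by simp at hx, rfl⟩
    rw [this]; simp
  | succ k ih =>
    have h := card_transv_step hF k
    rw [ih, hm, ← Nat.mul_sub] at h
    apply Nat.eq_of_mul_eq_mul_right (Nat.succ_pos k)
    rw [Nat.succ_eq_add_one, h, pow_succ]
    have := Nat.choose_succ_right_eq m k
    calc m.choose k * 2 ^ k * (2 * (m - k)) = (m.choose k * (m - k)) * (2 ^ k * 2) := by ring
      _ = _ := by rw [← this]; ring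

theorem card_cycles_support (k : ℕ) (hk : 2 ≤ k) (A : Finset α) (hA : #A = k) :
    #{c : Equiv.Perm α | c.IsCycle ∧ c.support = A} = (k - 1).factorial := by
  have h := Equiv.Perm.card_of_cycleType_singleton (α := A) hk (by simp [hA])
  rw [Fintype.card_coe, hA, Nat.choose_self, mul_one] at h
  rw [← h]
  symm
  apply card_bij (fun g _ => Equiv.Perm.ofSubtype g)
  · intro g hg
    simp only [mem_filter, mem_univ, true_and] at hg ⊢
    have h1 : (Equiv.Perm.ofSubtype g).cycleType = {k} := by
      rw [← hg]; convert Equiv.Perm.cycleType_ofSubtype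
    have h2 : (Equiv.Perm.ofSubtype g).IsCycle := by
      rw [← Equiv.Perm.card_cycleType_eq_one, h1]; simp
    refine ⟨h2, ?_⟩
    have h3 := h2.cycleType
    rw [h1, Multiset.singleton_inj] at h3
    apply eq_of_subset_of_card_le
    · intro x hx
      by_contra hx'
      exact (Equiv.Perm.mem_support.1 hx) (Equiv.Perm.ofSubtype_apply_of_not_mem g hx')
    · rw [← h3, hA]
  · intro a _ b _ hab
    exact Equiv.Perm.ofSubtype_injective hab
  · intro c hc
    simp only [mem_filter, mem_univ, true_and] at hc
    obtain ⟨h1, rfl⟩ := hc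
    have e : Equiv.Perm.ofSubtype (c.subtypePerm (p := fun x => x ∈ c.support)
        (fun x => Equiv.Perm.apply_mem_support)) = c :=
      Equiv.Perm.ofSubtype_subtypePerm _ (fun x hx => Equiv.Perm.mem_support.2 hx)
    refine ⟨_, ?_, e⟩
    simp only [mem_filter, mem_univ, true_and]
    have h4 := h1.cycleType
    rw [hA] at h4
    rw [← h4]
    conv_rhs => rw [← e]
    symm
    convert Equiv.Perm.cycleType_ofSubtype

theorem card_transv_cycles {F : Equiv.Perm α} (hF : IsPerfectMatching F) (m : ℕ)
    (hm : Fintype.card α = 2 * m) (k : ℕ) (hk : 2 ≤ k) :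
    #{c : Equiv.Perm α | c.IsCycle ∧ #c.support = k ∧ Transv F c.support}
      = m.choose k * 2 ^ k * (k - 1).factorial := by
  rw [← card_transv hF m hm k, ← mul_one (#{c : Equiv.Perm α | _})]
  apply card_mul_eq_card_mul (fun (c : Equiv.Perm α) A => c.support = A)
  · intro c hc
    simp only [mem_filter, mem_univ, true_and] at hc
    rw [card_eq_one]
    refine ⟨c.support, ?_⟩
    ext A
    simp only [mem_bipartiteAbove, mem_filter, mem_univ, true_and, mem_singleton]
    constructor
    · tauto
    · rintro rfl
      tauto
  · intro A hA
    simp only [mem_filter, mem_univ, true_and] at hA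
    rw [← card_cycles_support k hk A hA.2]
    congr 1
    ext c
    simp only [mem_bipartiteBelow, mem_filter, mem_univ, true_and]
    constructor
    · tauto
    · rintro ⟨h, rfl⟩
      tauto

theorem card_factors_two {k : ℕ} {σ : Equiv.Perm α} (h : σ.cycleType = {k, k}) :
    #σ.cycleFactorsFinset = 2 := by
  have := congrArg Multiset.card h
  rw [Equiv.Perm.cycleType_def, Multiset.card_map] at this
  simpa using this

theorem conj_mem_factors {F G c : Equiv.Perm α} (hF : IsPerfectMatching F)
    (hG : IsPerfectMatching G) (hc : c ∈ (F * G).cycleFactorsFinset) :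
    F * c⁻¹ * F⁻¹ ∈ (F * G).cycleFactorsFinset := by
  rw [Equiv.Perm.mem_cycleFactorsFinset_iff] at hc ⊢
  refine ⟨hc.1.inv.conj, ?_⟩
  intro a ha
  have hFi : F⁻¹ = F := inv_eq_of_mul_eq_one_left hF.1
  rw [Equiv.Perm.support_conj, Finset.mem_map_equiv] at ha
  have ha1 : F⁻¹ a ∈ c⁻¹.support := ha
  rw [hFi, Equiv.Perm.support_inv] at ha1
  rw [hFi]
  simp only [Equiv.Perm.mul_apply]
  congr 1
  have hb : c⁻¹ (F a) ∈ c.support := by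
    rw [← Equiv.Perm.apply_mem_support]; simpa using ha1
  have h1 := hc.2 _ hb
  rw [show c (c⁻¹ (F a)) = F a by simp, Equiv.Perm.mul_apply] at h1
  have h2 := F.injective h1
  have h3 := congrArg G h2
  rw [pm_FF hG] at h3
  exact h3.symm

theorem conj_disj {F c : Equiv.Perm α} (_hF : IsPerfectMatching F)
    (hc : Transv F c.support) : Equiv.Perm.Disjoint c (F * c⁻¹ * F⁻¹) := by
  rw [Equiv.Perm.disjoint_iff_disjoint_support, disjoint_left]
  intro x hx h
  rw [Equiv.Perm.support_conj, Finset.mem_map_equiv, Equiv.Perm.support_inv] at h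
  have := hc _ h
  simp at this
  exact (Equiv.Perm.mem_support.1 hx) this

theorem factors_eq {F G c : Equiv.Perm α} {k : ℕ} (hF : IsPerfectMatching F)
    (hG : IsPerfectMatching G) (hc : c ∈ (F * G).cycleFactorsFinset)
    (ht : Transv F c.support) (hk : (F * G).cycleType = {k, k}) :
    (F * G).cycleFactorsFinset = {c, F * c⁻¹ * F⁻¹} := by
  symm
  apply eq_of_subset_of_card_le
  · intro x hx
    rcases mem_insert.1 hx with rfl | hx
    · exact hc
    · rw [mem_singleton.1 hx]; exact conj_mem_factors hF hG hc
  · rw [card_factors_two hk, card_pair]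
    intro h
    have h1 := conj_disj hF ht
    rw [← h, Equiv.Perm.disjoint_refl_iff] at h1
    exact (Equiv.Perm.mem_cycleFactorsFinset_iff.1 hc).1.ne_one h1

theorem exists_matching {F c : Equiv.Perm α} {k : ℕ} (hF : IsPerfectMatching F)
    (hc : c.IsCycle) (hk : #c.support = k) (ht : Transv F c.support) :
    ∃ G, IsPerfectMatching G ∧ (F * G).cycleType = {k, k} ∧ c ∈ (F * G).cycleFactorsFinset := by
  have hd := conj_disj hF ht
  have hFi : F⁻¹ = F := inv_eq_of_mul_eq_one_left hF.1
  have e : F * (F * (c * (F * c⁻¹ * F⁻¹))) = c * (F * c⁻¹ * F⁻¹) := by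
    rw [← mul_assoc, hF.1, one_mul]
  refine ⟨F * (c * (F * c⁻¹ * F⁻¹)), ⟨?_, ?_⟩, ?_, ?_⟩
  · have h2 : F * F = 1 := hF.1
    rw [hFi]
    calc _ = F * c * F * c⁻¹ * (F * F) * c * F * c⁻¹ * F := by group
      _ = F * c * F * F * c⁻¹ * F := by rw [h2, mul_one]; group
      _ = F * c * (F * F) * c⁻¹ * F := by group
      _ = 1 := by rw [h2, mul_one, mul_assoc F c, mul_inv_cancel, mul_one, h2]
  · intro x hx
    have h1 : (c * (F * c⁻¹ * F⁻¹)) x = F x := by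
      rw [← e, Equiv.Perm.mul_apply, hx]
    by_cases h : c x = x
    · have hcomm := hd.commute.eq
      rw [hcomm, Equiv.Perm.mul_apply, h, hFi] at h1
      simp only [Equiv.Perm.mul_apply] at h1
      have h2 := F.injective h1
      have h3 : c x = F x := by
        have h6 := congrArg c h2
        rw [← h6]; simp
      exact hF.2 x (h3.symm.trans h)
    · have h5 : (F * c⁻¹ * F⁻¹) x = x := (hd x).resolve_left h
      rw [Equiv.Perm.mul_apply, h5] at h1
      have hx' : x ∈ c.support := Equiv.Perm.mem_support.2 h
      apply ht x hx'
      rw [← h1, Equiv.Perm.apply_mem_support]; exact hx'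
  · rw [e, hd.cycleType_mul, Equiv.Perm.cycleType_conj, Equiv.Perm.cycleType_inv, hc.cycleType, hk]
    rfl
  · rw [e, hd.cycleFactorsFinset_mul_eq_union, hc.cycleFactorsFinset_eq_singleton]
    simp

theorem factor_props {F G c : Equiv.Perm α} {k : ℕ} (hF : IsPerfectMatching F)
    (hG : IsPerfectMatching G) (hk : (F * G).cycleType = {k, k})
    (hc : c ∈ (F * G).cycleFactorsFinset) :
    c.IsCycle ∧ #c.support = k ∧ Transv F c.support := by
  have hc' := Equiv.Perm.mem_cycleFactorsFinset_iff.1 hc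
  refine ⟨hc'.1, ?_, ?_⟩
  · have : #c.support ∈ (F * G).cycleType := by
      rw [Equiv.Perm.cycleType_def]
      exact Multiset.mem_map_of_mem (Finset.card ∘ Equiv.Perm.support) hc
    rw [hk] at this
    simpa using this
  · intro x hx h
    obtain ⟨i, hi⟩ := (Equiv.Perm.isCycleOn_support_of_mem_cycleFactorsFinset hc).2 hx h
    exact pm_zpow_ne hF hG i x hi

theorem main_count {F : Equiv.Perm α} (hF : IsPerfectMatching F) (k : ℕ) :
    #{G : Equiv.Perm α | IsPerfectMatching G ∧ (F * G).cycleType = {k, k}} * 2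
     = #{c : Equiv.Perm α | c.IsCycle ∧ #c.support = k ∧ Transv F c.support} * 1 := by
  apply card_mul_eq_card_mul (fun G c : Equiv.Perm α => c ∈ (F * G).cycleFactorsFinset)
  · intro G hG
    simp only [mem_filter, mem_univ, true_and] at hG
    rw [← card_factors_two hG.2]
    congr 1
    ext c
    simp only [mem_bipartiteAbove, mem_filter, mem_univ, true_and]
    exact ⟨fun h => h.2, fun h => ⟨factor_props hF hG.1 hG.2 h, h⟩⟩
  · intro c hc
    simp only [mem_filter, mem_univ, true_and] at hc
    obtain ⟨G, hG, hGk, hGc⟩ := exists_matching hF hc.1 hc.2.1 hc.2.2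
    rw [card_eq_one]
    refine ⟨G, ?_⟩
    ext G'
    simp only [mem_bipartiteBelow, mem_filter, mem_univ, true_and, mem_singleton]
    constructor
    · rintro ⟨⟨h1, h2⟩, h3⟩
      have := (factors_eq hF h1 h3 hc.2.2 h2).trans (factors_eq hF hG hGc hc.2.2 hGk).symm
      exact mul_left_cancel (Equiv.Perm.cycleFactorsFinset_injective this)
    · rintro rfl
      exact ⟨⟨hG, hGk⟩, hGc⟩

end cnt

/-- The structure constant `c^{(2)}_{(k 1^n),(k 1^n);(1^{k+n})}` associated with zonal
polynomials (Jack parameter α = 2): for any perfect matching `F₁` of a set of size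
`2(k+n)`, the number of perfect matchings `F₃` with `Λ(F₁,F₃) = (k,1^n)` equals
`binom(k+n, k) * 2^(k-1) * (k-1)!`. -/
theorem count_matchings_with_given_union (k n : ℕ) (hk : 2 ≤ k)
    (F₁ : Equiv.Perm (Fin (2 * (k + n)))) (hF₁ : IsPerfectMatching F₁) :
    Nat.card {F₃ : Equiv.Perm (Fin (2 * (k + n))) //
        IsPerfectMatching F₃ ∧ (F₁ * F₃).cycleType = {k, k}}
      = (k + n).choose k * 2 ^ (k - 1) * Nat.factorial (k - 1) := by
  classical
  have h1 := main_count hF₁ k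
  have h2 := card_transv_cycles hF₁ (k + n) (by simp) k hk
  rw [mul_one, h2] at h1
  rw [Nat.card_eq_fintype_card, Fintype.card_subtype]
  apply Nat.eq_of_mul_eq_mul_right (show 0 < 2 by norm_num)
  obtain ⟨j, rfl⟩ : ∃ j, k = j + 1 := ⟨k - 1, by omega⟩
  convert h1 using 1
  · congr!
  · simp only [Nat.add_sub_cancel]
    ring
end

section
/- Let α be a finite type and let F₁, F₂ be permutations of α that are fixed-point-free involutions, i.e. F₁ * F₁ = 1, F₂ * F₂ = 1, and F₁ x ≠ x, F₂ x ≠ x for every x. Then there exists a multiset θ of natural numbers such that Equiv.Perm.cycleType (F₁ * F₂) = θ + θ; that is, each cycle length of the product of two perfect matchings occurs an even number of times. -/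
open Equiv Equiv.Perm in
theorem aux_no_same {α : Type*} (F G : Equiv.Perm α)
    (hF : F * F = 1) (hFf : ∀ x, F x ≠ x)
    (hG : G * G = 1) (hGf : ∀ x, G x ≠ x) (x : α) (k : ℤ)
    (h : F x = ((F * G) ^ k) x) : False := by
  have hFi : F⁻¹ = F := inv_eq_of_mul_eq_one_left hF
  have hGi : G⁻¹ = G := inv_eq_of_mul_eq_one_left hG
  have hs : F * (F * G) * F⁻¹ = (F * G)⁻¹ := by
    rw [mul_inv_rev, hFi, hGi, ← mul_assoc, hF, one_mul]
  have hk : ∀ j : ℤ, ∀ y, F (((F * G) ^ j) y) = ((F * G) ^ (-j)) (F y) := by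
    intro j y
    have h1 : F * (F * G) ^ j * F⁻¹ = (F * G) ^ (-j) := by
      rw [← conj_zpow, hs, inv_zpow, zpow_neg]
    rw [← h1]; simp
  have hGe : ∀ y, G y = F ((F * G) y) := by
    intro y
    have : G = F * (F * G) := by rw [← mul_assoc, hF, one_mul]
    conv_lhs => rw [this]
    rfl
  rcases Int.even_or_odd' k with ⟨m, hm | hm⟩
  · apply hFf (((F * G) ^ m) x)
    rw [hk, h, ← Perm.mul_apply, ← zpow_add]
    congr 2; omega
  · apply hGf (((F * G) ^ m) x)
    rw [hGe, ← Perm.mul_apply (F * G), ← zpow_one_add, hk, h, ← Perm.mul_apply, ← zpow_add]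
    congr 2; omega

open Equiv Equiv.Perm in
theorem aux_inv_mem {α : Type*} [Fintype α] [DecidableEq α] (f c : Equiv.Perm α)
    (h : c ∈ f.cycleFactorsFinset) : c⁻¹ ∈ f⁻¹.cycleFactorsFinset := by
  rw [mem_cycleFactorsFinset_iff] at h ⊢
  refine ⟨h.1.inv, fun a ha => ?_⟩
  rw [support_inv] at ha
  rw [Perm.eq_inv_iff_eq, ← h.2]
  · simp
  · have := (zpow_apply_mem_support (f := c) (n := -1) (x := a)).2 ha
    simpa using this

theorem aux_half (s : Multiset ℕ) (h : ∀ n, Even (s.count n)) : ∃ θ : Multiset ℕ, s = θ + θ := by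
  refine ⟨∑ n ∈ s.toFinset, (s.count n / 2) • {n}, ?_⟩
  rw [← Finset.sum_add_distrib]
  conv_lhs => rw [← Multiset.toFinset_sum_count_nsmul_eq s]
  refine Finset.sum_congr rfl fun n _ => ?_
  rw [← add_nsmul]
  congr 1
  obtain ⟨r, hr⟩ := h n
  omega

open Equiv Equiv.Perm in
/-- Each cycle length of the product of two perfect matchings (fixed-point-free
involutions) occurs an even number of times: the cycle type of `F₁ * F₂` is of the
form `θ + θ` for some multiset `θ`. -/
theorem cycleType_prod_matchings_doubled
    {α : Type*} [Fintype α] [DecidableEq α]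
    (F₁ F₂ : Equiv.Perm α)
    (hF₁inv : F₁ * F₁ = 1) (hF₁fpf : ∀ x, F₁ x ≠ x)
    (hF₂inv : F₂ * F₂ = 1) (hF₂fpf : ∀ x, F₂ x ≠ x) :
    ∃ θ : Multiset ℕ, (F₁ * F₂).cycleType = θ + θ := by
  apply aux_half
  intro n
  have hFi : F₁⁻¹ = F₁ := inv_eq_of_mul_eq_one_left hF₁inv
  have hGi : F₂⁻¹ = F₂ := inv_eq_of_mul_eq_one_left hF₂inv
  have hs : F₁ * (F₁ * F₂)⁻¹ * F₁⁻¹ = F₁ * F₂ := by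
    rw [mul_inv_rev, hFi, hGi, mul_assoc, mul_assoc, hF₁inv, mul_one]
  have hmem : ∀ c ∈ (F₁ * F₂).cycleFactorsFinset,
      F₁ * c⁻¹ * F₁⁻¹ ∈ (F₁ * F₂).cycleFactorsFinset := by
    intro c hc
    have := (mem_cycleFactorsFinset_conj (F₁ * F₂)⁻¹ F₁ c⁻¹).2 (aux_inv_mem _ _ hc)
    rwa [hs] at this
  rw [cycleType_def, Multiset.count_map]
  change Even ((F₁ * F₂).cycleFactorsFinset.filter fun c => n = c.support.card).card
  rw [← ZMod.natCast_eq_zero_iff_even, Finset.cast_card]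
  refine Finset.sum_involution (fun c _ => F₁ * c⁻¹ * F₁⁻¹) ?_ ?_ ?_ ?_
  · intros; decide
  · intro c hc _ heq
    rw [Finset.mem_filter] at hc
    have hc1 := mem_cycleFactorsFinset_iff.1 hc.1
    obtain ⟨x, hx⟩ := hc1.1.nonempty_support
    have hFx : F₁ x ∈ c.support := by
      rw [← heq]
      simpa using hx
    have hsc := (isCycleOn_support_of_mem_cycleFactorsFinset hc.1).2 hx hFx
    obtain ⟨k, hk⟩ := hsc
    exact aux_no_same F₁ F₂ hF₁inv hF₁fpf hF₂inv hF₂fpf x k hk.symm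
  · intro c hc
    rw [Finset.mem_filter] at hc ⊢
    refine ⟨hmem c hc.1, ?_⟩
    rw [card_support_conj, support_inv]; exact hc.2
  · intro c hc
    simp only [mul_inv_rev, inv_inv, hFi]
    calc _ = (F₁ * F₁) * c * (F₁ * F₁) := by group
      _ = c := by rw [hF₁inv]; simp
end

section
/- Let λ be a Young diagram, let k ≥ 2 be an integer, and define for each real α > 0 the k-th moment M_k^{(α)}(λ) of the transition measure of the α-anisotropic diagram A_α(λ) by the explicit formula M_k^{(α)}(λ) = Σ_{c addable} ( Π_{c' removable} (z_c − w_{c'}) / Π_{c' addable, c' ≠ c} (z_c − z_{c'}) ) · z_c^k, where for an addable corner c = (i, j) one sets z_c = √α · j − i/√α and for a removable corner c = (i, j) one sets w_c = √α · (j + 1) − (i + 1)/√α. Then there exists a polynomial p with integer coefficients such that for every real α > 0, (√α)^(k−2) · M_k^{(α)}(λ) = p evaluated at α. -/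
/-- A cell `c ∉ λ` is an addable (inner) corner of `λ` if inserting it yields the
cell set of a Young diagram. -/
def YoungDiagram.IsAddableCorner (lam : YoungDiagram) (c : ℕ × ℕ) : Prop :=
  c ∉ lam ∧ ∃ ν : YoungDiagram, ν.cells = insert c lam.cells

/-- A cell `c ∈ λ` is a removable (outer) corner of `λ` if deleting it yields the
cell set of a Young diagram. -/
def YoungDiagram.IsRemovableCorner (lam : YoungDiagram) (c : ℕ × ℕ) : Prop :=
  c ∈ lam ∧ ∃ ν : YoungDiagram, ν.cells = lam.cells.erase c

/-- The α-content `z_c = √α · j − i/√α` of an addable corner `c = (i, j)`. -/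
noncomputable def innerContent (a : ℝ) (c : ℕ × ℕ) : ℝ :=
  Real.sqrt a * c.2 - c.1 / Real.sqrt a

/-- The α-content `w_c = √α · (j+1) − (i+1)/√α` of a removable corner `c = (i, j)`. -/
noncomputable def outerContent (a : ℝ) (c : ℕ × ℕ) : ℝ :=
  Real.sqrt a * (c.2 + 1) - (c.1 + 1) / Real.sqrt a

/-- The `k`-th moment `M_k^{(α)}(λ)` of the transition measure of the α-anisotropic
diagram `A_α(λ)`, given by the explicit partial-fraction formula. -/
noncomputable def jackMoment (a : ℝ) (lam : YoungDiagram) (k : ℕ) : ℝ :=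
  ∑ᶠ c ∈ {c : ℕ × ℕ | lam.IsAddableCorner c},
    ((∏ᶠ c' ∈ {c' : ℕ × ℕ | lam.IsRemovableCorner c'},
        (innerContent a c - outerContent a c')) /
      ∏ᶠ c' ∈ {c' : ℕ × ℕ | lam.IsAddableCorner c' ∧ c' ≠ c},
        (innerContent a c - innerContent a c'))
      * innerContent a c ^ k

lemma jm_alg (R : Finset ℕ) (L : ℕ → ℕ) (k : ℕ) (hk : 1 ≤ k) :
    ∃ p : Polynomial ℤ, ∀ a : ℝ,
      Set.InjOn (fun i : ℕ => a * (L i : ℝ) - (i : ℝ)) (insert 0 (R.image (· + 1)) : Finset ℕ) →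
      ∑ i ∈ insert 0 (R.image (· + 1)),
        ((∏ r ∈ R, ((a * (L i : ℝ) - (i : ℝ)) - (a * (L r : ℝ) - ((r : ℝ) + 1)))) *
          (a * (L i : ℝ) - (i : ℝ)) ^ k) /
        ∏ j ∈ (insert 0 (R.image (· + 1))).erase i,
          ((a * (L i : ℝ) - (i : ℝ)) - (a * (L j : ℝ) - (j : ℝ)))
      = a * Polynomial.aeval a p := by
  classical
  set S : Finset ℕ := insert 0 (R.image (· + 1)) with hS
  let Z : ℕ → Polynomial ℤ := fun i => Polynomial.X * (L i : Polynomial ℤ) - (i : Polynomial ℤ)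
  let W : ℕ → Polynomial ℤ := fun r => Polynomial.X * (L r : Polynomial ℤ) - ((r : Polynomial ℤ) + 1)
  let Q : Polynomial (Polynomial ℤ) :=
    (∏ r ∈ R, (Polynomial.X - Polynomial.C (W r))) * Polynomial.X ^ k
  let D : Polynomial (Polynomial ℤ) := ∏ i ∈ S, (Polynomial.X - Polynomial.C (Z i))
  have hD : D.Monic := Polynomial.monic_prod_of_monic _ _ fun i _ => Polynomial.monic_X_sub_C _
  let N : Polynomial ℤ := (Q %ₘ D).coeff (S.card - 1)
  have hN0 : N.coeff 0 = 0 := by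
    have h1 : (Q %ₘ D).map (Polynomial.constantCoeff) = 0 := by
      rw [Polynomial.map_modByMonic _ hD]
      rw [Polynomial.modByMonic_eq_zero_iff_dvd (hD.map _)]
      have e1 : Q.map Polynomial.constantCoeff =
          (∏ r ∈ R, (Polynomial.X + Polynomial.C ((r : ℤ) + 1))) * Polynomial.X ^ k := by
        simp [Q, W, Polynomial.map_prod, Polynomial.map_mul]
        exact Finset.prod_congr rfl fun x _ => by ring
      have e2 : D.map Polynomial.constantCoeff =
          Polynomial.X * (∏ r ∈ R, (Polynomial.X + Polynomial.C ((r : ℤ) + 1))) := by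
        simp only [D, Polynomial.map_prod]
        rw [hS, Finset.prod_insert (by simp), Finset.prod_image (by simp)]
        simp [Z]
        exact Finset.prod_congr rfl fun x _ => by ring
      rw [e1, e2, mul_comm]
      exact mul_dvd_mul_left _ (dvd_pow_self _ (by omega))
    have h2 := congrArg (fun P => Polynomial.coeff P (S.card - 1)) h1
    simpa [N, Polynomial.coeff_map] using h2
  obtain ⟨p, hp⟩ := Polynomial.X_dvd_iff.mpr hN0
  refine ⟨p, fun a hinj => ?_⟩
  let f : Polynomial ℤ →+* ℝ := (Polynomial.aeval a : Polynomial ℤ →ₐ[ℤ] ℝ).toRingHom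
  have hfZ : ∀ i, f (Z i) = a * (L i : ℝ) - (i : ℝ) := fun i => by simp [f, Z]
  have hfW : ∀ i, f (W i) = a * (L i : ℝ) - ((i : ℝ) + 1) := fun i => by simp [f, W]
  have hfN : f N = a * Polynomial.aeval a p := by rw [hp]; simp [f]
  rw [← hfN]
  have h3 : f N = ((Q.map f) %ₘ (D.map f)).coeff (S.card - 1) := by
    rw [← Polynomial.map_modByMonic _ hD, Polynomial.coeff_map]
  have hDf : D.map f = ∏ i ∈ S, (Polynomial.X - Polynomial.C (a * (L i : ℝ) - (i : ℝ))) := by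
    simp only [D, Polynomial.map_prod, Polynomial.map_sub, Polynomial.map_X, Polynomial.map_C, hfZ]
  have hQf : Q.map f = (∏ r ∈ R, (Polynomial.X - Polynomial.C (a * (L r : ℝ) - ((r : ℝ) + 1))))
      * Polynomial.X ^ k := by
    simp only [Q, Polynomial.map_mul, Polynomial.map_pow, Polynomial.map_prod, Polynomial.map_sub,
      Polynomial.map_X, Polynomial.map_C, hfW]
  have hdeg : ((Q.map f) %ₘ (D.map f)).degree < S.card := by
    refine (Polynomial.degree_modByMonic_lt _ (hD.map f)).trans_eq ?_
    rw [hDf, Polynomial.degree_prod]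
    simp only [Polynomial.degree_X_sub_C]
    simp
  rw [h3, Lagrange.coeff_eq_sum hinj hdeg]
  refine Finset.sum_congr rfl fun i hi => ?_
  congr 1
  have h0 : (D.map f).eval (a * (L i : ℝ) - (i : ℝ)) = 0 := by
    rw [hDf, Polynomial.eval_prod]
    exact Finset.prod_eq_zero hi (by simp)
  rw [Polynomial.modByMonic_eq_sub_mul_div, Polynomial.eval_sub, Polynomial.eval_mul, h0, hQf]
  simp [Polynomial.eval_prod]

lemma jm_addable (lam : YoungDiagram) (c : ℕ × ℕ) : lam.IsAddableCorner c ↔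
    c.2 = lam.rowLen c.1 ∧ (c.1 = 0 ∨ lam.rowLen c.1 < lam.rowLen (c.1 - 1)) := by
  obtain ⟨i, j⟩ := c
  constructor
  · rintro ⟨h, ν, hν⟩
    have hm : ∀ x, x ∈ ν ↔ x = (i, j) ∨ x ∈ lam := fun x => by
      rw [← YoungDiagram.mem_cells, hν]; simp
    have hc : (i, j) ∈ ν := (hm _).2 (Or.inl rfl)
    rw [YoungDiagram.mem_iff_lt_rowLen] at h
    have hj : j = lam.rowLen i := by
      by_contra hne
      have h1 := (hm _).1 (ν.up_left_mem (le_refl i) (Nat.sub_le j 1) hc)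
      rw [YoungDiagram.mem_iff_lt_rowLen, Prod.mk.injEq] at h1
      omega
    refine ⟨hj, ?_⟩
    have h1 := (hm _).1 (ν.up_left_mem (Nat.sub_le i 1) (le_refl j) hc)
    rw [YoungDiagram.mem_iff_lt_rowLen, Prod.mk.injEq] at h1
    simp only
    omega
  · rintro ⟨hj, hi⟩
    simp only at hj hi
    refine ⟨by rw [YoungDiagram.mem_iff_lt_rowLen]; omega, ⟨insert (i, j) lam.cells, ?_⟩, rfl⟩
    rintro ⟨x, y⟩ ⟨x', y'⟩ hle hx
    obtain ⟨h1, h2⟩ := Prod.mk_le_mk.1 hle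
    simp only [Finset.coe_insert, Set.mem_insert_iff, Finset.mem_coe, YoungDiagram.mem_cells,
      Prod.mk.injEq] at hx ⊢
    rcases hx with ⟨rfl, rfl⟩ | hx
    · rw [YoungDiagram.mem_iff_lt_rowLen]
      rcases Nat.lt_or_ge x' x with h | h
      · have := lam.rowLen_anti x' (x - 1) (by omega)
        right; omega
      · obtain rfl : x' = x := by omega
        omega
    · exact Or.inr (lam.up_left_mem h1 h2 hx)

lemma jm_removable (lam : YoungDiagram) (c : ℕ × ℕ) : lam.IsRemovableCorner c ↔
    c.2 + 1 = lam.rowLen c.1 ∧ lam.rowLen (c.1 + 1) < lam.rowLen c.1 := by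
  obtain ⟨i, j⟩ := c
  constructor
  · rintro ⟨h, ν, hν⟩
    have hm : ∀ x, x ∈ ν ↔ x ≠ (i, j) ∧ x ∈ lam := fun x => by
      rw [← YoungDiagram.mem_cells, hν]; simp
    have hc : (i, j) ∉ ν := fun h => ((hm _).1 h).1 rfl
    rw [YoungDiagram.mem_iff_lt_rowLen] at h
    have h1 : ¬ (j + 1 < lam.rowLen i) := fun h' => hc <|
      ν.up_left_mem (le_refl i) (Nat.le_succ j)
        ((hm _).2 ⟨by simp, YoungDiagram.mem_iff_lt_rowLen.2 h'⟩)
    have h2 : ¬ (j < lam.rowLen (i + 1)) := fun h' => hc <|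
      ν.up_left_mem (Nat.le_succ i) (le_refl j)
        ((hm _).2 ⟨by simp, YoungDiagram.mem_iff_lt_rowLen.2 h'⟩)
    simp only
    omega
  · rintro ⟨hj, hi⟩
    simp only at hj hi
    refine ⟨by rw [YoungDiagram.mem_iff_lt_rowLen]; omega, ⟨lam.cells.erase (i, j), ?_⟩, rfl⟩
    rintro ⟨x, y⟩ ⟨x', y'⟩ hle hx
    obtain ⟨h1, h2⟩ := Prod.mk_le_mk.1 hle
    simp only [Finset.mem_coe, Finset.mem_erase, YoungDiagram.mem_cells, ne_eq,
      Prod.mk.injEq] at hx ⊢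
    refine ⟨?_, lam.up_left_mem h1 h2 hx.2⟩
    rintro ⟨rfl, rfl⟩
    have hx2 := hx.2
    rw [YoungDiagram.mem_iff_lt_rowLen] at hx2
    rcases Nat.lt_or_ge x' x with h | h
    · have := lam.rowLen_anti (x' + 1) x (by omega)
      omega
    · obtain rfl : x' = x := by omega
      omega

/-- `(√α)^(k−2) · M_k^{(α)}(λ)` is a polynomial in `α` with integer coefficients. -/
theorem sqrt_pow_mul_jackMoment_polynomial_in_alpha
    (lam : YoungDiagram) (k : ℕ) (hk : 2 ≤ k) :
    ∃ p : Polynomial ℤ, ∀ a : ℝ, 0 < a →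
      Real.sqrt a ^ (k - 2) * jackMoment a lam k = Polynomial.aeval a p := by
  classical
  set L : ℕ → ℕ := lam.rowLen with hL
  set R : Finset ℕ := (Finset.range (lam.colLen 0)).filter (fun i => L (i + 1) < L i) with hR
  have hmR : ∀ i, i ∈ R ↔ L (i + 1) < L i := by
    intro i
    rw [hR, Finset.mem_filter, Finset.mem_range]
    refine ⟨fun h => h.2, fun h => ⟨?_, h⟩⟩
    rw [← YoungDiagram.mem_iff_lt_colLen, YoungDiagram.mem_iff_lt_rowLen]
    exact lt_of_le_of_lt (Nat.zero_le _) h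
  obtain ⟨p, hp⟩ := jm_alg R L k (by omega)
  set S : Finset ℕ := insert 0 (R.image (· + 1)) with hS
  have hmS : ∀ i, i ∈ S ↔ (i = 0 ∨ L i < L (i - 1)) := by
    intro i
    rw [hS, Finset.mem_insert, Finset.mem_image]
    constructor
    · rintro (h | ⟨r, hr, rfl⟩)
      · exact Or.inl h
      · right; simpa using (hmR r).1 hr
    · rintro (h | h)
      · exact Or.inl h
      · rcases Nat.eq_zero_or_pos i with h0 | h0
        · exact Or.inl h0
        · right
          refine ⟨i - 1, (hmR _).2 ?_, by omega⟩
          rwa [Nat.sub_add_cancel h0]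
  have hcard : ∀ i ∈ S, (S.erase i).card = R.card := by
    intro i hi
    rw [Finset.card_erase_of_mem hi, hS, Finset.card_insert_of_notMem (by simp),
      Finset.card_image_of_injective _ (add_left_injective 1)]
    simp
  refine ⟨p, fun a ha => ?_⟩
  have hinj : Set.InjOn (fun i : ℕ => a * (L i : ℝ) - (i : ℝ)) (S : Set ℕ) := by
    have key : ∀ i i', i < i' → a * (L i : ℝ) - (i : ℝ) ≠ a * (L i' : ℝ) - (i' : ℝ) := by
      intro i i' hlt h
      have h1 : (L i' : ℝ) ≤ L i := by exact_mod_cast lam.rowLen_anti i i' hlt.le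
      have h2 : (i : ℝ) < i' := by exact_mod_cast hlt
      nlinarith
    intro i _ i' _ h
    rcases lt_trichotomy i i' with h' | h' | h'
    · exact absurd h (key _ _ h')
    · exact h'
    · exact absurd h.symm (key _ _ h')
  have hp' := hp a hinj
  have hs : 0 < Real.sqrt a := Real.sqrt_pos.2 ha
  have hss : Real.sqrt a * Real.sqrt a = a := Real.mul_self_sqrt ha.le
  set s := Real.sqrt a with hsdef
  have hz : ∀ i, innerContent a (i, L i) = (a * (L i : ℝ) - (i : ℝ)) / s := by
    intro i
    simp only [innerContent, ← hsdef]
    rw [← hss]; field_simp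
  have hw : ∀ i ∈ R, outerContent a (i, L i - 1) = (a * (L i : ℝ) - ((i : ℝ) + 1)) / s := by
    intro i hi
    have h1 : 1 ≤ L i := by have := (hmR i).1 hi; omega
    simp only [outerContent, ← hsdef]
    rw [← hss]; push_cast [h1]; field_simp; ring
  have hA : {c : ℕ × ℕ | lam.IsAddableCorner c} = (fun i => (i, L i)) '' (S : Set ℕ) := by
    ext ⟨i, j⟩
    simp only [Set.mem_ofPred_eq, jm_addable, Set.mem_image, Finset.mem_coe, hmS, Prod.mk.injEq]
    constructor
    · rintro ⟨h1, h2⟩; exact ⟨i, h2, rfl, h1.symm⟩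
    · rintro ⟨x, h2, rfl, h1⟩; exact ⟨h1.symm, h2⟩
  have hA' : ∀ i, {c : ℕ × ℕ | lam.IsAddableCorner c ∧ c ≠ (i, L i)} =
      (fun i => (i, L i)) '' (S.erase i : Finset ℕ) := by
    intro i0
    ext ⟨i, j⟩
    simp only [Set.mem_ofPred_eq, jm_addable, Set.mem_image, Finset.mem_coe, Finset.mem_erase, hmS,
      Prod.mk.injEq, ne_eq]
    constructor
    · rintro ⟨⟨h1, h2⟩, h3⟩
      exact ⟨i, ⟨fun h => h3 ⟨h, by rw [h1, ← h]⟩, h2⟩, rfl, h1.symm⟩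
    · rintro ⟨x, ⟨h3, h2⟩, rfl, h1⟩; exact ⟨⟨h1.symm, h2⟩, fun h => h3 h.1⟩
  have hB : {c : ℕ × ℕ | lam.IsRemovableCorner c} = (fun i => (i, L i - 1)) '' (R : Set ℕ) := by
    ext ⟨i, j⟩
    simp only [Set.mem_ofPred_eq, jm_removable, Set.mem_image, Finset.mem_coe, hmR, Prod.mk.injEq]
    constructor
    · rintro ⟨h1, h2⟩; exact ⟨i, h2, rfl, by rw [hL]; omega⟩
    · rintro ⟨x, h2, rfl, h1⟩; exact ⟨by rw [← hL]; omega, h2⟩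
  have hi1 : Function.Injective (fun i : ℕ => (i, L i)) := fun x y h => (Prod.mk.inj h).1
  have hi2 : Function.Injective (fun i : ℕ => (i, L i - 1)) := fun x y h => (Prod.mk.inj h).1
  have hJ : jackMoment a lam k = (∑ i ∈ S,
        ((∏ r ∈ R, ((a * (L i : ℝ) - (i : ℝ)) - (a * (L r : ℝ) - ((r : ℝ) + 1)))) *
          (a * (L i : ℝ) - (i : ℝ)) ^ k) /
        ∏ j ∈ S.erase i,
          ((a * (L i : ℝ) - (i : ℝ)) - (a * (L j : ℝ) - (j : ℝ)))) / s ^ k := by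
    unfold jackMoment
    rw [hA, finsum_mem_image hi1.injOn, finsum_mem_coe_finset, Finset.sum_div]
    refine Finset.sum_congr rfl fun i hi => ?_
    rw [hA', hB, finprod_mem_image hi1.injOn, finprod_mem_image hi2.injOn, finprod_mem_coe_finset,
      finprod_mem_coe_finset]
    have e1 : ∏ r ∈ R, (innerContent a (i, L i) - outerContent a (r, L r - 1)) =
        (∏ r ∈ R, ((a * (L i : ℝ) - (i : ℝ)) - (a * (L r : ℝ) - ((r : ℝ) + 1)))) / s ^ R.card := by
      rw [← Finset.prod_const, ← Finset.prod_div_distrib]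
      refine Finset.prod_congr rfl fun r hr => ?_
      rw [hz, hw r hr, ← sub_div]
    have e2 : ∏ j ∈ S.erase i, (innerContent a (i, L i) - innerContent a (j, L j)) =
        (∏ j ∈ S.erase i, ((a * (L i : ℝ) - (i : ℝ)) - (a * (L j : ℝ) - (j : ℝ)))) /
          s ^ R.card := by
      rw [← hcard i hi, ← Finset.prod_const, ← Finset.prod_div_distrib]
      refine Finset.prod_congr rfl fun r hr => ?_
      rw [hz, hz, ← sub_div]
    rw [e1, e2, hz, div_div_div_cancel_right₀ (pow_ne_zero _ hs.ne'), div_pow]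
    ring
  rw [hJ, hp']
  have hk' : s ^ k = s ^ (k - 2) * a := by
    rw [← hss, ← pow_two, ← pow_add]; congr 1; omega
  rw [hk']
  have := pow_ne_zero (k - 2) hs.ne'
  field_simp
end
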